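/- arXiv:math/0012206 — 7 statements merged into one kernel-verified Lean document; each statement's English description precedes it below -/
import Mathlib

section
/- Let P: V ⇉ W and Q: W ⇉ Y be linear relations between finite-dimensional complex vector spaces such that the pair (Q,P) is transversal. Then dim(QP) = dim Q + dim P − dim W. -/
open Module

noncomputable section

variable {V W Y Z : Type*}
  [AddCommGroup V] [Module ℂ V] [AddCommGroup W] [Module ℂ W]
  [AddCommGroup Y] [Module ℂ Y] [AddCommGroup Z] [Module ℂ Z]

/-- The kernel of a linear relation `P : V ⇉ W`. -/
def relKer (P : Submodule ℂ (V × W)) : Submodule ℂ V :=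
  P.comap (LinearMap.inl ℂ V W)

/-- The indefiniteness of a linear relation `P : V ⇉ W`. -/
def relIndef (P : Submodule ℂ (V × W)) : Submodule ℂ W :=
  P.comap (LinearMap.inr ℂ V W)

/-- The domain of a linear relation `P : V ⇉ W`. -/
def relDom (P : Submodule ℂ (V × W)) : Submodule ℂ V :=
  P.map (LinearMap.fst ℂ V W)

/-- The image of a linear relation `P : V ⇉ W`. -/
def relIm (P : Submodule ℂ (V × W)) : Submodule ℂ W :=
  P.map (LinearMap.snd ℂ V W)

/-- The product `QP` of two linear relations. -/
def relComp (Q : Submodule ℂ (W × Y)) (P : Submodule ℂ (V × W)) : Submodule ℂ (V × Y) where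
  carrier := {p | ∃ w : W, (p.1, w) ∈ P ∧ (w, p.2) ∈ Q}
  add_mem' := by
    rintro ⟨a, b⟩ ⟨c, d⟩ ⟨w₁, h₁, h₂⟩ ⟨w₂, h₃, h₄⟩
    exact ⟨w₁ + w₂, P.add_mem h₁ h₃, Q.add_mem h₂ h₄⟩
  zero_mem' := ⟨0, P.zero_mem, Q.zero_mem⟩
  smul_mem' := by
    rintro c ⟨a, b⟩ ⟨w, h₁, h₂⟩
    exact ⟨c • w, P.smul_mem c h₁, Q.smul_mem c h₂⟩

/-- The pair `(Q, P)` of linear relations is transversal. -/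
def Transversal (Q : Submodule ℂ (W × Y)) (P : Submodule ℂ (V × W)) : Prop :=
  relIm P ⊔ relDom Q = ⊤ ∧ relIndef P ⊓ relKer Q = ⊥

/-- The difference map `P × Q → W` sending `((v, w₁), (w₂, y))` to `w₁ - w₂`. -/
def relDiff (Q : Submodule ℂ (W × Y)) (P : Submodule ℂ (V × W)) : P × Q →ₗ[ℂ] W :=
  (LinearMap.snd ℂ V W ∘ₗ P.subtype).coprod (-(LinearMap.fst ℂ W Y ∘ₗ Q.subtype))

/-- The map `P × Q → V × Y` sending `((v, w₁), (w₂, y))` to `(v, y)`. -/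
def relOuter (Q : Submodule ℂ (W × Y)) (P : Submodule ℂ (V × W)) : P × Q →ₗ[ℂ] V × Y :=
  (LinearMap.fst ℂ V W ∘ₗ P.subtype).prodMap (LinearMap.snd ℂ W Y ∘ₗ Q.subtype)

theorem range_relDiff (Q : Submodule ℂ (W × Y)) (P : Submodule ℂ (V × W)) :
    LinearMap.range (relDiff Q P) = relIm P ⊔ relDom Q := by
  rw [relDiff, LinearMap.range_coprod, LinearMap.range_neg, LinearMap.range_comp,
    LinearMap.range_comp, Submodule.range_subtype, Submodule.range_subtype, relIm, relDom]

theorem mem_ker_relDiff {Q : Submodule ℂ (W × Y)} {P : Submodule ℂ (V × W)} {x : P × Q} :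
    x ∈ LinearMap.ker (relDiff Q P) ↔ x.1.1.2 = x.2.1.1 := by
  simp [relDiff, ← sub_eq_add_neg, sub_eq_zero]

theorem map_relOuter_ker_relDiff (Q : Submodule ℂ (W × Y)) (P : Submodule ℂ (V × W)) :
    (LinearMap.ker (relDiff Q P)).map (relOuter Q P) = relComp Q P := by
  ext ⟨v, y⟩
  constructor
  · rintro ⟨⟨⟨⟨a, b⟩, hp⟩, ⟨⟨c, d⟩, hq⟩⟩, hx, he⟩
    obtain rfl : b = c := mem_ker_relDiff.mp hx
    obtain ⟨rfl, rfl⟩ := Prod.mk.inj he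
    exact ⟨b, hp, hq⟩
  · rintro ⟨w, hp, hq⟩
    exact ⟨(⟨(v, w), hp⟩, ⟨(w, y), hq⟩), mem_ker_relDiff.mpr rfl, rfl⟩

theorem disjoint_ker_relDiff_ker_relOuter {Q : Submodule ℂ (W × Y)} {P : Submodule ℂ (V × W)}
    (h : relIndef P ⊓ relKer Q = ⊥) :
    Disjoint (LinearMap.ker (relDiff Q P)) (LinearMap.ker (relOuter Q P)) := by
  rw [Submodule.disjoint_def]
  rintro ⟨⟨⟨a, b⟩, hp⟩, ⟨⟨c, d⟩, hq⟩⟩ hx he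
  obtain rfl : b = c := mem_ker_relDiff.mp hx
  obtain ⟨rfl, rfl⟩ : a = 0 ∧ d = 0 := Prod.mk.inj he
  obtain rfl : b = 0 := (Submodule.mem_bot ℂ).mp (h ▸ ⟨hp, hq⟩)
  rfl

end

theorem dim_relComp_of_transversal
    {V W Y : Type*} [AddCommGroup V] [Module ℂ V] [AddCommGroup W] [Module ℂ W]
    [AddCommGroup Y] [Module ℂ Y]
    [FiniteDimensional ℂ V] [FiniteDimensional ℂ W] [FiniteDimensional ℂ Y]
    (P : Submodule ℂ (V × W)) (Q : Submodule ℂ (W × Y))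
    (h : Transversal Q P) :
    (finrank ℂ (relComp Q P) : ℤ) = finrank ℂ Q + finrank ℂ P - finrank ℂ W := by
  have rank_nullity := (relDiff Q P).finrank_range_add_finrank_ker
  rw [range_relDiff, h.1, finrank_top, finrank_prod] at rank_nullity
  have finrank_map : finrank ℂ (relComp Q P) = finrank ℂ (LinearMap.ker (relDiff Q P)) := by
    rw [← map_relOuter_ker_relDiff, ← LinearMap.range_domRestrict]
    exact LinearMap.finrank_range_of_inj <| LinearMap.injective_domRestrict_iff.mpr <|
      disjoint_ker_relDiff_ker_relOuter h.2
  omega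
end

section
/- Define the GA-composition of linear relations by Q ⋄ P = QP (the product of linear relations) if the pair (Q,P) is transversal, and Q ⋄ P = null otherwise, where null is a formal absorbing element (null ⋄ x = x ⋄ null = null for every morphism x). Then GA-composition is associative: for any linear relations P: V ⇉ W, Q: W ⇉ Y, R: Y ⇉ Z between finite-dimensional complex vector spaces, (R ⋄ Q) ⋄ P = R ⋄ (Q ⋄ P). -/
open Module

open Classical in
/-- GA-composition of morphisms of the category `GA`: a morphism `V ⇉ W` is either a linear
relation (`some P`) or the formal element `null` (`none`). -/
noncomputable def gaComp {V W Y : Type*}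
    [AddCommGroup V] [Module ℂ V] [AddCommGroup W] [Module ℂ W] [AddCommGroup Y] [Module ℂ Y]
    (Q : Option (Submodule ℂ (W × Y))) (P : Option (Submodule ℂ (V × W))) :
    Option (Submodule ℂ (V × Y)) :=
  match Q, P with
  | some Q, some P => if Transversal Q P then some (relComp Q P) else none
  | _, none => none
  | none, _ => none

section

variable {V W Y Z : Type*}
  [AddCommGroup V] [Module ℂ V] [AddCommGroup W] [Module ℂ W]
  [AddCommGroup Y] [Module ℂ Y] [AddCommGroup Z] [Module ℂ Z]

theorem mem_relComp {Q : Submodule ℂ (W × Y)} {P : Submodule ℂ (V × W)} {v : V} {y : Y} :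
    (v, y) ∈ relComp Q P ↔ ∃ w, (v, w) ∈ P ∧ (w, y) ∈ Q :=
  Iff.rfl

theorem relComp_assoc (P : Submodule ℂ (V × W)) (Q : Submodule ℂ (W × Y))
    (R : Submodule ℂ (Y × Z)) :
    relComp (relComp R Q) P = relComp R (relComp Q P) := by
  ext ⟨v, z⟩
  simp only [mem_relComp]
  constructor
  · rintro ⟨w, hP, y, hQ, hR⟩
    exact ⟨y, ⟨w, hP, hQ⟩, hR⟩
  · rintro ⟨y, ⟨w, hP, hQ⟩, hR⟩
    exact ⟨w, hP, y, hQ, hR⟩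

/-- Transversality in terms of elements. -/
theorem transversal_iff {Q : Submodule ℂ (W × Y)} {P : Submodule ℂ (V × W)} :
    Transversal Q P ↔
      (∀ w, ∃ v a b y, (v, a) ∈ P ∧ (b, y) ∈ Q ∧ a + b = w) ∧
        ∀ w, (0, w) ∈ P → (w, 0) ∈ Q → w = 0 := by
  unfold Transversal
  refine and_congr ?_ ?_
  · rw [Submodule.eq_top_iff']
    refine forall_congr' fun w => ?_
    simp only [Submodule.mem_sup, relIm, relDom, Submodule.mem_map, Prod.exists,
      LinearMap.fst_apply, LinearMap.snd_apply]
    constructor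
    · rintro ⟨_, ⟨v, a, hP, rfl⟩, _, ⟨b, y, hQ, rfl⟩, h⟩
      exact ⟨v, a, b, y, hP, hQ, h⟩
    · rintro ⟨v, a, b, y, hP, hQ, h⟩
      exact ⟨a, ⟨v, a, hP, rfl⟩, b, ⟨b, y, hQ, rfl⟩, h⟩
  · simp [Submodule.eq_bot_iff, relIndef, relKer]

theorem transversal_and_transversal_relComp_iff (P : Submodule ℂ (V × W))
    (Q : Submodule ℂ (W × Y)) (R : Submodule ℂ (Y × Z)) :
    Transversal R Q ∧ Transversal (relComp R Q) P ↔
      Transversal Q P ∧ Transversal R (relComp Q P) := by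
  simp only [transversal_iff, mem_relComp]
  constructor
  · rintro ⟨⟨hRQ, kRQ⟩, hP, kP⟩
    refine ⟨⟨fun w => ?_, fun w h₁ h₂ => kP w h₁ ⟨0, h₂, R.zero_mem⟩⟩, fun y => ?_, ?_⟩
    · obtain ⟨v, a, b, z, h₁, ⟨y, h₂, -⟩, h⟩ := hP w
      exact ⟨v, a, b, y, h₁, h₂, h⟩
    · obtain ⟨w, q, r, z, hq, hr, rfl⟩ := hRQ y
      obtain ⟨v, p, d, z', hp, ⟨e, hd, he⟩, rfl⟩ := hP w
      refine ⟨v, q - e, e + r, z' + z, ⟨p, hp, ?_⟩, R.add_mem he hr, by abel⟩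
      simpa using Q.sub_mem hq hd
    · rintro y ⟨w, h₁, h₂⟩ h₃
      obtain rfl := kP w h₁ ⟨y, h₂, h₃⟩
      exact kRQ y h₂ h₃
  · rintro ⟨⟨hQP, kQP⟩, hR, kR⟩
    refine ⟨⟨fun y => ?_, fun y h₁ h₂ => kR y ⟨0, P.zero_mem, h₁⟩ h₂⟩, fun w => ?_, ?_⟩
    · obtain ⟨v, a, b, z, ⟨w, -, h₁⟩, h₂, h⟩ := hR y
      exact ⟨w, a, b, z, h₁, h₂, h⟩
    · obtain ⟨v, p, d, e, hp, hd, rfl⟩ := hQP w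
      obtain ⟨v', f, r, z, ⟨w', hw', hf⟩, hr, rfl⟩ := hR e
      refine ⟨v + v', p + w', d - w', z, P.add_mem hp hw', ⟨r, ?_, hr⟩, by abel⟩
      simpa using Q.sub_mem hd hf
    · rintro w h₁ ⟨y, h₂, h₃⟩
      obtain rfl := kR y ⟨w, h₁, h₂⟩ h₃
      exact kQP w h₁ h₂

end

theorem gaComp_assoc
    {V W Y Z : Type*} [AddCommGroup V] [Module ℂ V] [AddCommGroup W] [Module ℂ W]
    [AddCommGroup Y] [Module ℂ Y] [AddCommGroup Z] [Module ℂ Z]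
    [FiniteDimensional ℂ V] [FiniteDimensional ℂ W] [FiniteDimensional ℂ Y]
    [FiniteDimensional ℂ Z]
    (P : Submodule ℂ (V × W)) (Q : Submodule ℂ (W × Y)) (R : Submodule ℂ (Y × Z)) :
    gaComp (gaComp (some R) (some Q)) (some P) =
      gaComp (some R) (gaComp (some Q) (some P)) := by
  have key := transversal_and_transversal_relComp_iff P Q R
  by_cases h₁ : Transversal R Q <;> by_cases h₂ : Transversal Q P <;>
    by_cases h₃ : Transversal R (relComp Q P) <;> simp_all [gaComp, relComp_assoc]
end

section
/- Every linear relation S: V ⇉ W between finite-dimensional complex vector spaces admits a canonical basis pair. Moreover, in any canonical basis pair for S one necessarily has γ = dim Ker S, μ = dim Indef S, β = rk S, α = dim V − dim Dom S, and ν = dim W − dim Im S. -/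
open Module

noncomputable section

variable {V W : Type*} [AddCommGroup V] [Module ℂ V] [AddCommGroup W] [Module ℂ W]

/-- A canonical basis pair for a linear relation `S : V ⇉ W`: a basis
`f₁,…,f_α, g₁,…,g_β, h₁,…,h_γ` of `V` and a basis `F₁,…,F_μ, G₁,…,G_β, H₁,…,H_ν` of `W`
such that `S` is spanned by the vectors `(0,Fᵢ)`, `(gⱼ,Gⱼ)`, `(hₗ,0)`. -/
structure CanonicalBasisPair (S : Submodule ℂ (V × W)) where
  α : ℕ
  β : ℕ
  γ : ℕ
  μ : ℕ
  ν : ℕ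
  bV : Basis (Fin α ⊕ Fin β ⊕ Fin γ) ℂ V
  bW : Basis (Fin μ ⊕ Fin β ⊕ Fin ν) ℂ W
  hspan : S = Submodule.span ℂ
      (Set.range (fun i : Fin μ => ((0 : V), bW (Sum.inl i))) ∪
       Set.range (fun j : Fin β => (bV (Sum.inr (Sum.inl j)), bW (Sum.inr (Sum.inl j)))) ∪
       Set.range (fun l : Fin γ => (bV (Sum.inr (Sum.inr l)), (0 : W))))

end

/-- The rank-nullity formula for the first projection of a linear relation. -/
theorem finrank_eq_relDom_add_relIndef {V W : Type*} [AddCommGroup V] [Module ℂ V]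
    [AddCommGroup W] [Module ℂ W] [FiniteDimensional ℂ V] [FiniteDimensional ℂ W]
    (S : Submodule ℂ (V × W)) :
    finrank ℂ S = finrank ℂ (relDom S) + finrank ℂ (relIndef S) := by
  have hrn := ((LinearMap.fst ℂ V W).domRestrict S).finrank_range_add_finrank_ker
  have hrange : ((LinearMap.fst ℂ V W).domRestrict S).range = relDom S := by
    rw [LinearMap.range_domRestrict, relDom]
  let e : relIndef S ≃ₗ[ℂ] ((LinearMap.fst ℂ V W).domRestrict S).ker :=
    { toFun := fun w => ⟨⟨(0, w.1), w.2⟩, rfl⟩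
      map_add' := fun x y => by ext <;> simp
      map_smul' := fun a x => by ext <;> simp
      invFun := fun p => ⟨p.1.1.2, by
        obtain ⟨⟨⟨v, w⟩, hp⟩, hv⟩ := p
        obtain rfl : v = 0 := hv
        exact hp⟩
      left_inv := fun _ => rfl
      right_inv := fun p => by
        obtain ⟨⟨⟨v, w⟩, hp⟩, hv⟩ := p
        obtain rfl : v = 0 := hv
        rfl }
  rw [hrange] at hrn
  rw [← hrn, e.finrank_eq]

/-- The rank-nullity formula for the second projection of a linear relation. -/
theorem finrank_eq_relIm_add_relKer {V W : Type*} [AddCommGroup V] [Module ℂ V]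
    [AddCommGroup W] [Module ℂ W] [FiniteDimensional ℂ V] [FiniteDimensional ℂ W]
    (S : Submodule ℂ (V × W)) :
    finrank ℂ S = finrank ℂ (relIm S) + finrank ℂ (relKer S) := by
  have hrn := ((LinearMap.snd ℂ V W).domRestrict S).finrank_range_add_finrank_ker
  have hrange : ((LinearMap.snd ℂ V W).domRestrict S).range = relIm S := by
    rw [LinearMap.range_domRestrict, relIm]
  let e : relKer S ≃ₗ[ℂ] ((LinearMap.snd ℂ V W).domRestrict S).ker :=
    { toFun := fun v => ⟨⟨(v.1, 0), v.2⟩, rfl⟩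
      map_add' := fun x y => by ext <;> simp
      map_smul' := fun a x => by ext <;> simp
      invFun := fun p => ⟨p.1.1.1, by
        obtain ⟨⟨⟨v, w⟩, hp⟩, hw⟩ := p
        obtain rfl : w = 0 := hw
        exact hp⟩
      left_inv := fun _ => rfl
      right_inv := fun p => by
        obtain ⟨⟨⟨v, w⟩, hp⟩, hw⟩ := p
        obtain rfl : w = 0 := hw
        rfl }
  rw [hrange] at hrn
  rw [← hrn, e.finrank_eq]

/-- The linear relation spanned by the vectors `(0, F i)`, `(g j, G j)` and `(h l, 0)`. -/
def relSpan {V W ι κ τ : Type*} [AddCommGroup V] [Module ℂ V] [AddCommGroup W] [Module ℂ W]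
    (F : ι → W) (g : κ → V) (G : κ → W) (h : τ → V) : Submodule ℂ (V × W) :=
  Submodule.span ℂ
    (Set.range (fun i => ((0 : V), F i)) ∪ Set.range (fun j => (g j, G j)) ∪
      Set.range (fun l => (h l, (0 : W))))

section relSpan

variable {V W ι κ τ : Type*} [AddCommGroup V] [Module ℂ V] [AddCommGroup W] [Module ℂ W]
  (F : ι → W) (g : κ → V) (G : κ → W) (h : τ → V)

theorem relSpan_le {F : ι → W} {g : κ → V} {G : κ → W} {h : τ → V} {S : Submodule ℂ (V × W)}
    (hF : ∀ i, (0, F i) ∈ S) (hg : ∀ j, (g j, G j) ∈ S) (hh : ∀ l, (h l, 0) ∈ S) :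
    relSpan F g G h ≤ S := by
  refine Submodule.span_le.2 ?_
  rintro _ ((⟨i, rfl⟩ | ⟨j, rfl⟩) | ⟨l, rfl⟩)
  exacts [hF i, hg j, hh l]

theorem inr_mem_relSpan (i : ι) : ((0 : V), F i) ∈ relSpan F g G h :=
  Submodule.subset_span (Or.inl (Or.inl ⟨i, rfl⟩))

theorem pair_mem_relSpan (j : κ) : (g j, G j) ∈ relSpan F g G h :=
  Submodule.subset_span (Or.inl (Or.inr ⟨j, rfl⟩))

theorem inl_mem_relSpan (l : τ) : (h l, (0 : W)) ∈ relSpan F g G h :=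
  Submodule.subset_span (Or.inr ⟨l, rfl⟩)

theorem relDom_relSpan :
    relDom (relSpan F g G h) = Submodule.span ℂ (Set.range (Sum.elim g h)) := by
  apply le_antisymm
  · refine Submodule.map_le_iff_le_comap.2 (relSpan_le (fun i => ?_) (fun j => ?_) fun l => ?_)
    · exact (Submodule.span ℂ (Set.range (Sum.elim g h))).zero_mem
    · exact Submodule.subset_span ⟨Sum.inl j, rfl⟩
    · exact Submodule.subset_span ⟨Sum.inr l, rfl⟩
  · refine Submodule.span_le.2 ?_
    rintro _ ⟨j | l, rfl⟩
    · exact ⟨_, pair_mem_relSpan F g G h j, rfl⟩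
    · exact ⟨_, inl_mem_relSpan F g G h l, rfl⟩

theorem relIm_relSpan :
    relIm (relSpan F g G h) = Submodule.span ℂ (Set.range (Sum.elim F G)) := by
  apply le_antisymm
  · refine Submodule.map_le_iff_le_comap.2 (relSpan_le (fun i => ?_) (fun j => ?_) fun l => ?_)
    · exact Submodule.subset_span ⟨Sum.inl i, rfl⟩
    · exact Submodule.subset_span ⟨Sum.inr j, rfl⟩
    · exact (Submodule.span ℂ (Set.range (Sum.elim F G))).zero_mem
  · refine Submodule.span_le.2 ?_
    rintro _ ⟨i | j, rfl⟩
    · exact ⟨_, inr_mem_relSpan F g G h i, rfl⟩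
    · exact ⟨_, pair_mem_relSpan F g G h j, rfl⟩

theorem span_le_relIndef_relSpan :
    Submodule.span ℂ (Set.range F) ≤ relIndef (relSpan F g G h) := by
  refine Submodule.span_le.2 ?_
  rintro _ ⟨i, rfl⟩
  exact inr_mem_relSpan F g G h i

theorem span_le_relKer_relSpan :
    Submodule.span ℂ (Set.range h) ≤ relKer (relSpan F g G h) := by
  refine Submodule.span_le.2 ?_
  rintro _ ⟨l, rfl⟩
  exact inl_mem_relSpan F g G h l

theorem finrank_relSpan_le [Fintype ι] [Fintype κ] [Fintype τ] :
    finrank ℂ (relSpan F g G h) ≤ Fintype.card ι + Fintype.card κ + Fintype.card τ := by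
  have hle := finrank_range_le_card (R := ℂ)
    (Sum.elim (Sum.elim (fun i => ((0 : V), F i)) fun j => (g j, G j)) fun l => (h l, (0 : W)))
  rw [Set.Sum.elim_range, Set.Sum.elim_range] at hle
  simp only [Fintype.card_sum] at hle
  exact hle

end relSpan

/-- A linear relation contained in another one is equal to it as soon as it has the same domain
and the same indefiniteness. -/
theorem eq_of_le_of_relDom_le_of_relIndef_le {V W : Type*} [AddCommGroup V] [Module ℂ V]
    [AddCommGroup W] [Module ℂ W] {R S : Submodule ℂ (V × W)} (hRS : R ≤ S)
    (hDom : relDom S ≤ relDom R) (hIndef : relIndef S ≤ relIndef R) : R = S := by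
  refine le_antisymm hRS ?_
  rintro ⟨v, w⟩ hvw
  obtain ⟨⟨v', w'⟩, hR, rfl⟩ := hDom ⟨_, hvw, rfl⟩
  have hdiff : ((0 : V), w - w') ∈ R := hIndef (by
    have hsub := S.sub_mem hvw (hRS hR)
    rwa [Prod.mk_sub_mk, LinearMap.fst_apply, sub_self] at hsub)
  simpa using R.add_mem hR hdiff

/-- A finite linearly independent family extends to a basis. -/
theorem LinearIndependent.exists_basis_sum_fin {V ι : Type*} [AddCommGroup V] [Module ℂ V]
    [FiniteDimensional ℂ V] {v : ι → V} (hv : LinearIndependent ℂ v) :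
    ∃ (n : ℕ) (b : Basis (Fin n ⊕ ι) ℂ V), ∀ i, b (Sum.inr i) = v i := by
  let b := Basis.sumExtend hv
  have : Finite (ι ⊕ Basis.sumExtendIndex hv) := Module.Finite.finite_basis b
  have : Finite (Basis.sumExtendIndex hv) := Finite.sum_right ι
  obtain ⟨n, ⟨e⟩⟩ := Finite.exists_equiv_fin (Basis.sumExtendIndex hv)
  refine ⟨n, b.reindex ((Equiv.sumComm _ _).trans (e.sumCongr (Equiv.refl ι))), fun i => ?_⟩
  simp only [Basis.reindex_apply, Equiv.symm_trans_apply, Equiv.sumCongr_symm,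
    Equiv.sumCongr_apply, Sum.map_inr, Equiv.refl_symm, Equiv.refl_apply, Equiv.sumComm_symm,
    Equiv.sumComm_apply, Sum.swap_inr, b, Basis.sumExtend, Basis.extend_apply_self]
  rfl

theorem nonempty_canonicalBasisPair {V W : Type*} [AddCommGroup V] [Module ℂ V]
    [AddCommGroup W] [Module ℂ W] [FiniteDimensional ℂ V] [FiniteDimensional ℂ W]
    (S : Submodule ℂ (V × W)) : Nonempty (CanonicalBasisPair S) := by
  have hKD : relKer S ≤ relDom S := fun v hv => ⟨(v, 0), hv, rfl⟩
  let h := finBasis ℂ (relKer S)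
  have hh : LinearIndependent ℂ (fun l => Submodule.inclusion hKD (h l)) :=
    h.linearIndependent.map' _ (Submodule.ker_inclusion _ _ _)
  obtain ⟨β, d, hd⟩ := hh.exists_basis_sum_fin
  have hdV : LinearIndependent ℂ (fun i => (d i : V)) :=
    d.linearIndependent.map' (relDom S).subtype (Submodule.ker_subtype _)
  obtain ⟨α, bV, hbV⟩ := hdV.exists_basis_sum_fin
  have hG : ∀ j, ∃ w, (bV (Sum.inr (Sum.inl j)), w) ∈ S := by
    intro j
    obtain ⟨⟨v, w⟩, hvw, hv⟩ := (d (Sum.inl j)).2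
    refine ⟨w, ?_⟩
    rwa [hbV, ← hv]
  choose G hGS using hG
  let F := finBasis ℂ (relIndef S)
  have hspan : relSpan (fun i => (F i : W)) (fun j => bV (Sum.inr (Sum.inl j))) G
      (fun l => bV (Sum.inr (Sum.inr l))) = S := by
    refine eq_of_le_of_relDom_le_of_relIndef_le
      (relSpan_le (fun i => (F i).2) hGS fun l => ?_) ?_ ?_
    · rw [hbV, hd]
      exact (h l).2
    · have hd' := congrArg (Submodule.map (relDom S).subtype) d.span_eq
      rw [Submodule.map_span, Submodule.map_subtype_top, ← Set.range_comp] at hd'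
      rw [relDom_relSpan]
      refine hd'.symm.trans_le (Submodule.span_mono ?_)
      rintro _ ⟨j | l, rfl⟩
      · exact ⟨Sum.inl j, hbV _⟩
      · exact ⟨Sum.inr l, hbV _⟩
    · have hF' := congrArg (Submodule.map (relIndef S).subtype) F.span_eq
      rw [Submodule.map_span, Submodule.map_subtype_top, ← Set.range_comp] at hF'
      refine hF'.symm.trans_le ?_
      exact span_le_relIndef_relSpan _ _ _ _
  have hFG : LinearIndependent ℂ (Sum.elim (fun i => (F i : W)) G) := by
    rw [linearIndependent_iff_card_eq_finrank_span, Set.finrank,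
      ← relIm_relSpan _ (fun j => bV (Sum.inr (Sum.inl j))) _
        (fun l => bV (Sum.inr (Sum.inr l))), hspan]
    have hdim := finrank_eq_card_basis d
    have h₁ := finrank_eq_relDom_add_relIndef S
    have h₂ := finrank_eq_relIm_add_relKer S
    simp only [Fintype.card_sum, Fintype.card_fin] at hdim ⊢
    omega
  obtain ⟨ν, bW, hbW⟩ := hFG.exists_basis_sum_fin
  refine ⟨⟨α, β, _, _, ν, bV,
    bW.reindex ((Equiv.sumComm _ _).trans (Equiv.sumAssoc _ _ _)), ?_⟩⟩
  simpa [hbW, relSpan] using hspan.symm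

namespace CanonicalBasisPair

variable {V W : Type*} [AddCommGroup V] [Module ℂ V] [AddCommGroup W] [Module ℂ W]
  {S : Submodule ℂ (V × W)} (c : CanonicalBasisPair S)

theorem eq_relSpan : S = relSpan (fun i => c.bW (Sum.inl i)) (fun j => c.bV (Sum.inr (Sum.inl j)))
    (fun j => c.bW (Sum.inr (Sum.inl j))) (fun l => c.bV (Sum.inr (Sum.inr l))) :=
  c.hspan

theorem finrank_relDom : finrank ℂ (relDom S) = c.β + c.γ := by
  have hli : LinearIndependent ℂ (Sum.elim (fun j => c.bV (Sum.inr (Sum.inl j)))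
      fun l => c.bV (Sum.inr (Sum.inr l))) := by
    convert c.bV.linearIndependent.comp _ Sum.inr_injective using 1
    ext (j | l) <;> rfl
  have heq := congrArg relDom c.eq_relSpan
  rw [relDom_relSpan] at heq
  rw [heq, finrank_span_eq_card hli]
  simp

theorem finrank_relIm : finrank ℂ (relIm S) = c.μ + c.β := by
  have hli : LinearIndependent ℂ (Sum.elim (fun i => c.bW (Sum.inl i))
      fun j => c.bW (Sum.inr (Sum.inl j))) := by
    convert c.bW.linearIndependent.comp (Sum.map id Sum.inl)
      (Function.injective_id.sumMap Sum.inl_injective) using 1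
    ext (i | j) <;> rfl
  have heq := congrArg relIm c.eq_relSpan
  rw [relIm_relSpan] at heq
  rw [heq, finrank_span_eq_card hli]
  simp

theorem finrank_le : finrank ℂ S ≤ c.μ + c.β + c.γ := by
  have hle := finrank_relSpan_le (fun i => c.bW (Sum.inl i))
    (fun j => c.bV (Sum.inr (Sum.inl j))) (fun j => c.bW (Sum.inr (Sum.inl j)))
    (fun l => c.bV (Sum.inr (Sum.inr l)))
  rw [← c.eq_relSpan] at hle
  simpa using hle

theorem le_finrank_relKer [FiniteDimensional ℂ V] : c.γ ≤ finrank ℂ (relKer S) := by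
  have hle := Submodule.finrank_mono (span_le_relKer_relSpan (fun i => c.bW (Sum.inl i))
    (fun j => c.bV (Sum.inr (Sum.inl j))) (fun j => c.bW (Sum.inr (Sum.inl j)))
    (fun l => c.bV (Sum.inr (Sum.inr l))))
  rw [← c.eq_relSpan] at hle
  have hli : LinearIndependent ℂ (fun l => c.bV (Sum.inr (Sum.inr l))) :=
    c.bV.linearIndependent.comp _ (Sum.inr_injective.comp Sum.inr_injective)
  rwa [finrank_span_eq_card hli, Fintype.card_fin] at hle

theorem le_finrank_relIndef [FiniteDimensional ℂ W] : c.μ ≤ finrank ℂ (relIndef S) := by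
  have hle := Submodule.finrank_mono (span_le_relIndef_relSpan (fun i => c.bW (Sum.inl i))
    (fun j => c.bV (Sum.inr (Sum.inl j))) (fun j => c.bW (Sum.inr (Sum.inl j)))
    (fun l => c.bV (Sum.inr (Sum.inr l))))
  rw [← c.eq_relSpan] at hle
  have hli : LinearIndependent ℂ (fun i => c.bW (Sum.inl i)) :=
    c.bW.linearIndependent.comp _ Sum.inl_injective
  rwa [finrank_span_eq_card hli, Fintype.card_fin] at hle

end CanonicalBasisPair

theorem exists_canonicalBasisPair_and_unique_counts
    {V W : Type*} [AddCommGroup V] [Module ℂ V] [AddCommGroup W] [Module ℂ W]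
    [FiniteDimensional ℂ V] [FiniteDimensional ℂ W]
    (S : Submodule ℂ (V × W)) :
    Nonempty (CanonicalBasisPair S) ∧
      ∀ c : CanonicalBasisPair S,
        c.γ = finrank ℂ (relKer S) ∧
        c.μ = finrank ℂ (relIndef S) ∧
        (c.β : ℤ) = finrank ℂ S - finrank ℂ (relKer S) - finrank ℂ (relIndef S) ∧
        (c.α : ℤ) = finrank ℂ V - finrank ℂ (relDom S) ∧
        (c.ν : ℤ) = finrank ℂ W - finrank ℂ (relIm S) := by
  refine ⟨nonempty_canonicalBasisPair S, fun c => ?_⟩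
  have hV := finrank_eq_card_basis c.bV
  have hW := finrank_eq_card_basis c.bW
  simp only [Fintype.card_sum, Fintype.card_fin] at hV hW
  have hDom := c.finrank_relDom
  have hIm := c.finrank_relIm
  have hKer := c.le_finrank_relKer
  have hIndef := c.le_finrank_relIndef
  have hS := c.finrank_le
  have h₁ := finrank_eq_relDom_add_relIndef S
  have h₂ := finrank_eq_relIm_add_relKer S
  omega
end

section
/- Let P: V ⇉ W and Q: W ⇉ Y be linear relations between finite-dimensional complex vector spaces, and let λ(P): Λ(V) → Λ(W) and λ(Q): Λ(W) → Λ(Y) be operators obtained from canonical basis pairs for P and Q. (a) If the pair (Q,P) is transversal, then for any operator λ(QP): Λ(V) → Λ(Y) obtained from a canonical basis pair for the product QP, there exists a nonzero constant c ∈ ℂ with λ(Q) ∘ λ(P) = c·λ(QP). (b) If the pair (Q,P) is not transversal, then λ(Q) ∘ λ(P) = 0. -/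
open Module

noncomputable section

variable {V W : Type*} [AddCommGroup V] [Module ℂ V] [AddCommGroup W] [Module ℂ W]

/-- The tuple `f₁, …, f_α, g_{i₁}, …, g_{i_s}` (with `i₁ < … < i_s` the elements of `s`)
in `V`, associated with a canonical basis pair. -/
def goodTupleV {S : Submodule ℂ (V × W)} (c : CanonicalBasisPair S)
    (s : Finset (Fin c.β)) : Fin (c.α + s.card) → V :=
  Fin.addCases (fun i => c.bV (Sum.inl i))
    (fun j => c.bV (Sum.inr (Sum.inl ((s.orderIsoOfFin rfl j : s) : Fin c.β))))

/-- The tuple `F₁, …, F_μ, G_{i₁}, …, G_{i_s}` (with `i₁ < … < i_s` the elements of `s`)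
in `W`, associated with a canonical basis pair. -/
def goodTupleW {S : Submodule ℂ (V × W)} (c : CanonicalBasisPair S)
    (s : Finset (Fin c.β)) : Fin (c.μ + s.card) → W :=
  Fin.addCases (fun i => c.bW (Sum.inl i))
    (fun j => c.bW (Sum.inr (Sum.inl ((s.orderIsoOfFin rfl j : s) : Fin c.β))))

/-- `L : Λ(V) → Λ(W)` is the operator `λ(S)` obtained from the canonical basis pair `c` for `S`:
it sends each basis monomial `f₁∧…∧f_α∧g_{i₁}∧…∧g_{i_s}` to `F₁∧…∧F_μ∧G_{i₁}∧…∧G_{i_s}` and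
every other monomial in the chosen basis of `V` (i.e. every monomial of basis vectors that
misses some `f` or contains some `h`) to `0`. -/
def IsLambda {S : Submodule ℂ (V × W)} (c : CanonicalBasisPair S)
    (L : ExteriorAlgebra ℂ V →ₗ[ℂ] ExteriorAlgebra ℂ W) : Prop :=
  (∀ s : Finset (Fin c.β),
      L (ExteriorAlgebra.ιMulti ℂ _ (goodTupleV c s)) =
        ExteriorAlgebra.ιMulti ℂ _ (goodTupleW c s)) ∧
  (∀ (k : ℕ) (x : Fin k → (Fin c.α ⊕ Fin c.β ⊕ Fin c.γ)),
      ((∃ i : Fin c.α, Sum.inl i ∉ Set.range x) ∨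
        (∃ l : Fin c.γ, Sum.inr (Sum.inr l) ∈ Set.range x)) →
      L (ExteriorAlgebra.ιMulti ℂ k (fun i => c.bV (x i))) = 0)

end


noncomputable section

variable {K V W : Type*} [Field K] [AddCommGroup V] [Module K V] [AddCommGroup W] [Module K W]

/-- The action of `V × V*` on `Λ(V)`: vectors act by exterior multiplication and covectors
by contraction. -/
def cliffordOp : (V × Dual K V) →ₗ[K] End K (ExteriorAlgebra K V) :=
  (LinearMap.mul K (ExteriorAlgebra K V) ∘ₗ ExteriorAlgebra.ι K).coprod
    (CliffordAlgebra.contractLeft (Q := (0 : QuadraticForm K V)))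

/-- The canonical symmetric pairing on `V × V*`. -/
def hyperbolicPairing (p q : V × Dual K V) : K := p.2 q.1 + q.2 p.1

theorem cliffordOp_apply (p : V × Dual K V) (x : ExteriorAlgebra K V) :
    cliffordOp p x = ExteriorAlgebra.ι K p.1 * x +
      CliffordAlgebra.contractLeft (Q := (0 : QuadraticForm K V)) p.2 x := by
  simp [cliffordOp]

theorem cliffordOp_vector (v : V) (x : ExteriorAlgebra K V) :
    cliffordOp (K := K) (v, 0) x = ExteriorAlgebra.ι K v * x := by
  simp [cliffordOp_apply]

theorem contractLeft_ι_mul' (ξ : Dual K V) (v : V) (x : ExteriorAlgebra K V) :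
    CliffordAlgebra.contractLeft (Q := (0 : QuadraticForm K V)) ξ (ExteriorAlgebra.ι K v * x) =
      ξ v • x - ExteriorAlgebra.ι K v *
        CliffordAlgebra.contractLeft (Q := (0 : QuadraticForm K V)) ξ x :=
  CliffordAlgebra.contractLeft_ι_mul ξ v x

theorem ι_mul_ι_mul_comm (v w : V) (x : ExteriorAlgebra K V) :
    ExteriorAlgebra.ι K v * (ExteriorAlgebra.ι K w * x) =
      -(ExteriorAlgebra.ι K w * (ExteriorAlgebra.ι K v * x)) := by
  rw [eq_neg_iff_add_eq_zero, ← mul_assoc, ← mul_assoc, ← add_mul,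
    ExteriorAlgebra.ι_add_mul_swap, zero_mul]

theorem cliffordOp_anticomm (p q : V × Dual K V) (x : ExteriorAlgebra K V) :
    cliffordOp p (cliffordOp q x) = hyperbolicPairing p q • x - cliffordOp q (cliffordOp p x) := by
  simp only [cliffordOp_apply, map_add, contractLeft_ι_mul', hyperbolicPairing, add_smul]
  rw [ι_mul_ι_mul_comm p.1 q.1, CliffordAlgebra.contractLeft_comm p.2 q.2]
  abel

theorem map_contractLeft (a : V →ₗ[K] W) (η : Dual K W) (x : ExteriorAlgebra K V) :
    ExteriorAlgebra.map a
        (CliffordAlgebra.contractLeft (Q := (0 : QuadraticForm K V)) (η ∘ₗ a) x) =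
      CliffordAlgebra.contractLeft (Q := (0 : QuadraticForm K W)) η (ExteriorAlgebra.map a x) := by
  induction x using CliffordAlgebra.left_induction with
  | algebraMap r =>
    rw [CliffordAlgebra.contractLeft_algebraMap, map_zero, AlgHom.commutes,
      CliffordAlgebra.contractLeft_algebraMap]
  | add x y hx hy => simp only [map_add, hx, hy]
  | ι_mul x m hx =>
    have h := contractLeft_ι_mul' (η ∘ₗ a) m x
    change ExteriorAlgebra.map a (CliffordAlgebra.contractLeft (η ∘ₗ a)
      (ExteriorAlgebra.ι K m * x)) = CliffordAlgebra.contractLeft η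
        (ExteriorAlgebra.map a (ExteriorAlgebra.ι K m * x))
    rw [h, map_mul, ExteriorAlgebra.map_apply_ι, contractLeft_ι_mul', map_sub, map_smul, map_mul,
      hx, ExteriorAlgebra.map_apply_ι]
    rfl

/-- A submodule `M` is stable under `S` if it is preserved by the operators of all elements
of `S`. -/
def CliffordStable (S : Set (V × Dual K V)) (M : Submodule K (ExteriorAlgebra K V)) : Prop :=
  ∀ p ∈ S, ∀ x ∈ M, cliffordOp p x ∈ M

theorem CliffordStable.span {S : Set (V × Dual K V)} {M : Submodule K (ExteriorAlgebra K V)}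
    (h : CliffordStable S M) : CliffordStable (Submodule.span K S : Set (V × Dual K V)) M := by
  intro p hp x hx
  induction hp using Submodule.span_induction with
  | mem p hp => exact h p hp x hx
  | zero => simp
  | add p q _ _ hp hq => simpa using M.add_mem hp hq
  | smul c p _ hp => simpa using M.smul_mem c hp

theorem eq_top_of_one_mem {M : Submodule K (ExteriorAlgebra K V)}
    (h : CliffordStable Set.univ M) (h1 : 1 ∈ M) : M = ⊤ := by
  rw [Submodule.eq_top_iff']
  intro x
  induction x using CliffordAlgebra.left_induction with
  | algebraMap r => rw [Algebra.algebraMap_eq_smul_one]; exact M.smul_mem r h1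
  | add x y hx hy => exact M.add_mem hx hy
  | ι_mul x m hx =>
    have := h (m, 0) trivial x hx
    rwa [cliffordOp_vector] at this

/-- If `R` is stable under `A`, `N` is stable under `B`, and `A ∪ B` spans `V × V*`, then
`R ≤ N` forces `N` to be everything as soon as `R` contains an element generating `Λ(V)`. -/
theorem eq_top_of_cliffordStable {A B : Set (V × Dual K V)}
    (hAB : Submodule.span K (A ∪ B) = ⊤) {R N : Submodule K (ExteriorAlgebra K V)}
    (hR : CliffordStable A R) (hN : CliffordStable B N) (hRN : R ≤ N)
    {z : ExteriorAlgebra K V} (hz : z ∈ R)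
    (hcyc : ∀ M : Submodule K (ExteriorAlgebra K V), CliffordStable Set.univ M → z ∈ M → 1 ∈ M) :
    N = ⊤ := by
  let M : Submodule K (ExteriorAlgebra K V) :=
    sInf {M | R ≤ M ∧ CliffordStable B M}
  have hRM : R ≤ M := le_sInf fun _ h => h.1
  have hMN : M ≤ N := sInf_le ⟨hRN, hN⟩
  have hMB : CliffordStable B M := by
    intro p hp x hx
    rw [Submodule.mem_sInf] at hx ⊢
    exact fun L hL => hL.2 p hp x (hx L hL)
  have hMA : CliffordStable A M := by
    intro p hp
    let M' : Submodule K (ExteriorAlgebra K V) := M ⊓ M.comap (cliffordOp p)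
    have : M ≤ M' := by
      refine sInf_le ⟨fun x hx => ⟨hRM hx, hRM (hR p hp x hx)⟩, ?_⟩
      rintro q hq x ⟨hx, hx'⟩
      refine ⟨hMB q hq x hx, ?_⟩
      rw [SetLike.mem_coe, Submodule.mem_comap, cliffordOp_anticomm]
      exact M.sub_mem (M.smul_mem _ hx) (hMB q hq _ hx')
    exact fun x hx => (this hx).2
  have hM : CliffordStable (A ∪ B) M := by
    rintro p (hp | hp)
    exacts [hMA p hp, hMB p hp]
  have hM' : CliffordStable Set.univ M := by
    have := hM.span
    rwa [hAB] at this
  exact top_le_iff.1 (eq_top_of_one_mem hM' (hcyc M hM' (hRM hz)) ▸ hMN)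

/-- A linear functional vanishing on the kernel of a linear map factors through it. -/
theorem exists_dual_comp_eq {E : Type*} [AddCommGroup E] [Module K E] (T : E →ₗ[K] V)
    (φ : Dual K E) (h : ∀ x, T x = 0 → φ x = 0) : ∃ ψ : Dual K V, ∀ x, ψ (T x) = φ x := by
  have : φ ∈ LinearMap.range T.dualMap := by
    rw [LinearMap.range_dualMap_eq_dualAnnihilator_ker, Submodule.mem_dualAnnihilator]
    exact h
  obtain ⟨ψ, rfl⟩ := this
  exact ⟨ψ, fun _ => rfl⟩

theorem cliffordOp_sq {p : V × Dual K V} (hp : p.2 p.1 = 0) (x : ExteriorAlgebra K V) :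
    cliffordOp p (cliffordOp p x) = 0 := by
  have h : ExteriorAlgebra.ι K p.1 * (ExteriorAlgebra.ι K p.1 * x) = 0 := by
    rw [← mul_assoc, ExteriorAlgebra.ι_sq_zero, zero_mul]
  simp only [cliffordOp_apply, map_add, contractLeft_ι_mul', hp, h,
    CliffordAlgebra.contractLeft_contractLeft]
  simp

/-- An element that lies in the sum of the ranges of finitely many creation operators and is
killed by the corresponding annihilation operators vanishes. -/
theorem eq_zero_of_annihilated {ι : Type*} (a b : ι → V × Dual K V) [DecidableEq ι]
    (hab : ∀ i j, hyperbolicPairing (a i) (b j) = if i = j then 1 else 0)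
    (hbb : ∀ i j, (b i).2 (b j).1 = 0) (s : Finset ι) (u : ExteriorAlgebra K V)
    (hu : u ∈ s.sup fun i => LinearMap.range (cliffordOp (b i)))
    (ha : ∀ i ∈ s, cliffordOp (a i) u = 0) : u = 0 := by
  induction s using Finset.induction_on with
  | empty => simpa using hu
  | insert e s he ih =>
    have key : ∀ p, (∀ i ∈ s, hyperbolicPairing p (b i) = 0) →
        ∀ x ∈ s.sup (fun i => LinearMap.range (cliffordOp (b i))),
          cliffordOp p x ∈ s.sup (fun i => LinearMap.range (cliffordOp (b i))) := by
      intro p hp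
      suffices s.sup (fun i => LinearMap.range (cliffordOp (b i))) ≤
          (s.sup (fun i => LinearMap.range (cliffordOp (b i)))).comap (cliffordOp p) from this
      refine Finset.sup_le fun i hi => ?_
      rintro _ ⟨y, rfl⟩
      rw [Submodule.mem_comap, cliffordOp_anticomm, hp i hi, zero_smul, zero_sub]
      exact neg_mem (Finset.le_sup (f := fun i => LinearMap.range (cliffordOp (b i))) hi ⟨_, rfl⟩)
    refine ih ?_ fun i hi => ha i (Finset.mem_insert_of_mem hi)
    rw [Finset.sup_insert] at hu
    obtain ⟨_, ⟨y, rfl⟩, u', hu', rfl⟩ := Submodule.mem_sup.1 hu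
    have h1 := cliffordOp_anticomm (a e) (b e) (cliffordOp (b e) y + u')
    rw [hab, if_pos rfl, one_smul, ha e (Finset.mem_insert_self _ _), map_zero, sub_zero] at h1
    rw [← h1, map_add, cliffordOp_sq (hbb e e), zero_add]
    refine key _ (fun i hi => ?_) _ (key _ (fun i hi => ?_) _ hu')
    · rw [hab, if_neg]
      rintro rfl
      exact he hi
    · simp [hyperbolicPairing, hbb]

/-! ### Products of operators -/

theorem cliffordOp_prod_anticomm (p : V × Dual K V) (l : List (V × Dual K V))
    (h : ∀ q ∈ l, hyperbolicPairing p q = 0) (x : ExteriorAlgebra K V) :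
    (l.map cliffordOp).prod (cliffordOp p x) =
      (-1 : K) ^ l.length • cliffordOp p ((l.map cliffordOp).prod x) := by
  induction l with
  | nil => simp
  | cons q l ih =>
    rw [List.forall_mem_cons] at h
    have h2 := cliffordOp_anticomm p q ((l.map cliffordOp).prod x)
    rw [h.1, zero_smul, zero_sub] at h2
    rw [List.map_cons, List.prod_cons, Module.End.mul_apply, Module.End.mul_apply, ih h.2, h2,
      map_smul, List.length_cons, pow_succ, mul_neg_one, neg_smul, smul_neg, neg_neg]

theorem cliffordOp_prod_of_mem {p : V × Dual K V} (hp : p.2 p.1 = 0) (l : List (V × Dual K V))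
    (h : ∀ q ∈ l, hyperbolicPairing p q = 0) (hpl : p ∈ l) (x : ExteriorAlgebra K V) :
    cliffordOp p ((l.map cliffordOp).prod x) = 0 := by
  induction l with
  | nil => simp at hpl
  | cons q l ih =>
    rw [List.forall_mem_cons] at h
    rw [List.map_cons, List.prod_cons, Module.End.mul_apply]
    rcases List.mem_cons.1 hpl with rfl | hpl
    · exact cliffordOp_sq hp _
    · rw [cliffordOp_anticomm, h.1, zero_smul, zero_sub, ih h.2 hpl, map_zero, neg_zero]

theorem prod_cliffordOp_of_mem {p : V × Dual K V} (hp : p.2 p.1 = 0) (l : List (V × Dual K V))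
    (h : ∀ q ∈ l, hyperbolicPairing p q = 0) (hpl : p ∈ l) (x : ExteriorAlgebra K V) :
    (l.map cliffordOp).prod (cliffordOp p x) = 0 := by
  rw [cliffordOp_prod_anticomm p l h, cliffordOp_prod_of_mem hp l h hpl, smul_zero]

theorem prod_reverse_cliffordOp {ι : Type*} [DecidableEq ι] (c d : ι → V × Dual K V)
    (hcd : ∀ i j, hyperbolicPairing (c i) (d j) = if i = j then 1 else 0) (l : List ι)
    (hl : l.Nodup) (x : ExteriorAlgebra K V) (hx : ∀ i ∈ l, cliffordOp (c i) x = 0) :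
    ((l.map c).reverse.map cliffordOp).prod (((l.map d).map cliffordOp).prod x) = x := by
  induction l with
  | nil => simp
  | cons i l ih =>
    rw [List.forall_mem_cons] at hx
    rw [List.nodup_cons] at hl
    have h0 : cliffordOp (c i) (((l.map d).map cliffordOp).prod x) = 0 := by
      have h := cliffordOp_prod_anticomm (c i) (l.map d) (fun q hq => by
        obtain ⟨j, hj, rfl⟩ := List.mem_map.1 hq
        rw [hcd, if_neg]
        rintro rfl
        exact hl.1 hj) x
      rw [hx.1, map_zero, eq_comm, smul_eq_zero] at h
      exact h.resolve_left (by simp)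
    simp only [List.map_cons, List.reverse_cons, List.map_append, List.prod_append,
      List.prod_cons, List.map_nil, List.prod_nil, mul_one, Module.End.mul_apply]
    rw [cliffordOp_anticomm, hcd, if_pos rfl, one_smul, h0, map_zero, sub_zero]
    exact ih hl.2 hx.2

theorem CliffordStable.prod_mem {M : Submodule K (ExteriorAlgebra K V)}
    (hM : CliffordStable Set.univ M) (l : List (V × Dual K V)) {x : ExteriorAlgebra K V}
    (hx : x ∈ M) : (l.map cliffordOp).prod x ∈ M := by
  induction l with
  | nil => simpa
  | cons q l ih => exact hM q trivial _ ih

/-- The grading involution of the exterior algebra. -/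
def gradeInvolution : ExteriorAlgebra K V →ₗ[K] ExteriorAlgebra K V :=
  (ExteriorAlgebra.map (-LinearMap.id : V →ₗ[K] V)).toLinearMap

theorem gradeInvolution_cliffordOp (p : V × Dual K V) (x : ExteriorAlgebra K V) :
    gradeInvolution (cliffordOp p x) = -cliffordOp p (gradeInvolution x) := by
  have h := map_contractLeft (-LinearMap.id : V →ₗ[K] V) (-p.2) x
  have h2 : (-p.2) ∘ₗ (-LinearMap.id : V →ₗ[K] V) = p.2 := by ext; simp
  rw [h2] at h
  simp only [gradeInvolution, cliffordOp_apply, AlgHom.toLinearMap_apply, map_add, map_mul, h,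
    ExteriorAlgebra.map_apply_ι]
  simp only [LinearMap.neg_apply, LinearMap.id_apply, map_neg, neg_mul]
  abel

theorem gradeInvolution_prod (l : List (V × Dual K V)) (x : ExteriorAlgebra K V) :
    gradeInvolution ((l.map cliffordOp).prod x) =
      (-1 : K) ^ l.length • (l.map cliffordOp).prod (gradeInvolution x) := by
  induction l with
  | nil => simp
  | cons q l ih =>
    rw [List.map_cons, List.prod_cons, Module.End.mul_apply, Module.End.mul_apply,
      gradeInvolution_cliffordOp, ih, map_smul, List.length_cons, pow_succ, mul_neg_one, neg_smul]

theorem gradeInvolution_map (a : V →ₗ[K] W) (x : ExteriorAlgebra K V) :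
    gradeInvolution (ExteriorAlgebra.map a x) = ExteriorAlgebra.map a (gradeInvolution x) := by
  simp only [gradeInvolution, AlgHom.toLinearMap_apply, ← AlgHom.comp_apply,
    ExteriorAlgebra.map_comp_map]
  congr 2
  ext
  simp

theorem gradeInvolution_one : gradeInvolution (1 : ExteriorAlgebra K V) = 1 := by
  simp [gradeInvolution]

/-! ### Annihilation and creation operators of a split basis -/

section Vacuum

variable {n : ℕ} {κ : Type*} (b : Basis (Fin n ⊕ κ) K V)

/-- The annihilation operators of the monomial `b₁ ∧ ⋯ ∧ bₙ`. -/
def annih : Fin n ⊕ κ → V × Dual K V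
  | .inl i => (b (.inl i), 0)
  | .inr k => (0, b.coord (.inr k))

/-- The creation operators of the monomial `b₁ ∧ ⋯ ∧ bₙ`. -/
def creat : Fin n ⊕ κ → V × Dual K V
  | .inl i => (0, b.coord (.inl i))
  | .inr k => (b (.inr k), 0)

/-- The pairs `(bᵢ, 0)` for `i = 1, …, n`. -/
def wedgeList : List (V × Dual K V) := (List.finRange n).map fun i => annih b (.inl i)

/-- The pairs `(0, bᵢ*)` for `i = n, …, 1`. -/
def contractList : List (V × Dual K V) :=
  ((List.finRange n).map fun i => creat b (.inl i)).reverse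

/-- The monomial `b₁ ∧ ⋯ ∧ bₙ`. -/
def vacuum : ExteriorAlgebra K V := ((wedgeList b).map cliffordOp).prod 1

theorem length_wedgeList : (wedgeList b).length = n := by simp [wedgeList]

theorem length_contractList : (contractList b).length = n := by simp [contractList]

theorem annih_creat [DecidableEq κ] (i j : Fin n ⊕ κ) :
    hyperbolicPairing (annih b i) (creat b j) = if i = j then 1 else 0 := by
  rcases i with i | i <;> rcases j with j | j <;>
    simp [hyperbolicPairing, annih, creat, Finsupp.single_apply, eq_comm]

theorem creat_creat (i j : Fin n ⊕ κ) : (creat b i).2 (creat b j).1 = 0 := by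
  rcases i with i | i <;> rcases j with j | j <;> simp [creat]

theorem annih_annih (i j : Fin n ⊕ κ) : (annih b i).2 (annih b j).1 = 0 := by
  rcases i with i | i <;> rcases j with j | j <;> simp [annih]

theorem span_annih_creat [Fintype κ] :
    Submodule.span K (Set.range (annih b) ∪ Set.range (creat b)) = ⊤ := by
  classical
  have h1 : ∀ i, (b i, (0 : Dual K V)) ∈
      Submodule.span K (Set.range (annih b) ∪ Set.range (creat b)) := by
    rintro (i | i)
    · exact Submodule.subset_span (.inl ⟨.inl i, rfl⟩)
    · exact Submodule.subset_span (.inr ⟨.inr i, rfl⟩)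
  have h2 : ∀ i, ((0 : V), b.coord i) ∈
      Submodule.span K (Set.range (annih b) ∪ Set.range (creat b)) := by
    rintro (i | i)
    · exact Submodule.subset_span (.inr ⟨.inl i, rfl⟩)
    · exact Submodule.subset_span (.inl ⟨.inr i, rfl⟩)
  rw [Submodule.eq_top_iff']
  rintro ⟨v, ξ⟩
  have hv : v = ∑ i, b.repr v i • b i := (b.sum_repr v).symm
  have hξ : ξ = ∑ i, ξ (b i) • b.coord i := by
    refine b.ext fun j => ?_
    simp
  have : (v, ξ) = ∑ i, b.repr v i • (b i, (0 : Dual K V)) +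
      ∑ i, ξ (b i) • ((0 : V), b.coord i) := by
    ext1
    · simp only [Prod.fst_add, Prod.fst_sum, Prod.smul_mk, smul_zero, Finset.sum_const_zero,
        add_zero]
      exact hv
    · simp only [Prod.snd_add, Prod.snd_sum, Prod.smul_mk, smul_zero, Finset.sum_const_zero,
        zero_add]
      exact hξ
  rw [this]
  exact add_mem (sum_mem fun i _ => Submodule.smul_mem _ _ (h1 i))
    (sum_mem fun i _ => Submodule.smul_mem _ _ (h2 i))

theorem contract_wedge (x : ExteriorAlgebra K V)
    (hx : ∀ i, cliffordOp (creat b (.inl i)) x = 0) :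
    ((contractList b).map cliffordOp).prod (((wedgeList b).map cliffordOp).prod x) = x := by
  classical
  refine prod_reverse_cliffordOp (fun i => creat b (.inl i)) (fun i => annih b (.inl i)) ?_ _
    (List.nodup_finRange n) x fun i _ => hx i
  intro i j
  simp [hyperbolicPairing, annih, creat, Finsupp.single_apply, eq_comm]

theorem one_mem_of_vacuum_mem (M : Submodule K (ExteriorAlgebra K V))
    (hM : CliffordStable Set.univ M) (h : vacuum b ∈ M) : 1 ∈ M := by
  have := hM.prod_mem (contractList b) h
  rwa [vacuum, contract_wedge] at this
  intro i
  simp [cliffordOp_apply, creat, CliffordAlgebra.contractLeft_one]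

theorem annih_vacuum (i : Fin n ⊕ κ) : cliffordOp (annih b i) (vacuum b) = 0 := by
  have h : ∀ q ∈ wedgeList b, hyperbolicPairing (annih b i) q = 0 := by
    intro q hq
    obtain ⟨j, -, rfl⟩ := List.mem_map.1 hq
    simp [hyperbolicPairing, annih_annih]
  rcases i with i | i
  · refine cliffordOp_prod_of_mem (annih_annih b _ _) _ h ?_ _
    exact List.mem_map.2 ⟨i, List.mem_finRange i, rfl⟩
  · have := cliffordOp_prod_anticomm _ _ h 1
    rw [← vacuum, show cliffordOp (annih b (.inr i)) 1 = 0 by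
      simp [cliffordOp_apply, annih, CliffordAlgebra.contractLeft_one], map_zero, eq_comm,
      smul_eq_zero] at this
    exact this.resolve_left (by simp)

theorem vacuum_ne_zero : vacuum b ≠ 0 := by
  intro h
  have := one_mem_of_vacuum_mem b ⊥ (fun p _ x hx => by simp_all) (by simp [h])
  simp at this

/-- A submodule containing the vacuum and stable under the creation operators is everything. -/
theorem eq_top_of_vacuum_mem [Fintype κ] (N : Submodule K (ExteriorAlgebra K V))
    (hN : CliffordStable (Set.range (creat b)) N) (h : vacuum b ∈ N) : N = ⊤ := by
  refine eq_top_of_cliffordStable (span_annih_creat b) (R := Submodule.span K {vacuum b})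
    ?_ hN (by simpa) (Submodule.mem_span_singleton_self _) (one_mem_of_vacuum_mem b)
  rintro _ ⟨i, rfl⟩ x hx
  obtain ⟨c, rfl⟩ := Submodule.mem_span_singleton.1 hx
  simp [annih_vacuum]

/-- The vacuum is determined up to scalars by its annihilation operators. -/
theorem mem_span_vacuum [Fintype κ] (z : ExteriorAlgebra K V)
    (hz : ∀ i, cliffordOp (annih b i) z = 0) : z ∈ Submodule.span K {vacuum b} := by
  classical
  let U := Finset.univ.sup fun i => LinearMap.range (cliffordOp (creat b i))
  have htop : Submodule.span K {vacuum b} ⊔ U = ⊤ := by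
    refine eq_top_of_vacuum_mem b _ ?_
      (Submodule.mem_sup_left (Submodule.mem_span_singleton_self _))
    rintro _ ⟨i, rfl⟩ x -
    exact Submodule.mem_sup_right
      (Finset.le_sup (f := fun i => LinearMap.range (cliffordOp (creat b i)))
        (Finset.mem_univ i) ⟨_, rfl⟩)
  obtain ⟨w, hw, u, hu, rfl⟩ := Submodule.mem_sup.1 (htop ▸ Submodule.mem_top : z ∈ _)
  obtain ⟨c, rfl⟩ := Submodule.mem_span_singleton.1 hw
  have : u = 0 := by
    refine eq_zero_of_annihilated (annih b) (creat b) (annih_creat b) (creat_creat b) _ u hu ?_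
    intro i _
    have := hz i
    rwa [map_add, map_smul, annih_vacuum, smul_zero, zero_add] at this
  rwa [this, add_zero]

end Vacuum

end

/-! ### Monomials -/

noncomputable section

variable {K V W : Type*} [Field K] [AddCommGroup V] [Module K V] [AddCommGroup W] [Module K W]

theorem wedge_eq_ιMulti_mul {n : ℕ} {κ : Type*} (b : Basis (Fin n ⊕ κ) K V)
    (x : ExteriorAlgebra K V) :
    ((wedgeList b).map cliffordOp).prod x =
      ExteriorAlgebra.ιMulti K n (fun i => b (.inl i)) * x := by
  have : ∀ l : List (Fin n), ((l.map fun i => annih b (.inl i)).map cliffordOp).prod x =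
      (l.map fun i => ExteriorAlgebra.ι K (b (.inl i))).prod * x := by
    intro l
    induction l with
    | nil => simp
    | cons i l ih =>
      rw [List.map_cons, List.map_cons, List.prod_cons, Module.End.mul_apply, ih, List.map_cons,
        List.prod_cons, mul_assoc, annih, cliffordOp_vector]
  rw [wedgeList, this, ExteriorAlgebra.ιMulti_apply, List.ofFn_eq_map]

theorem contract_ιMulti_eq_zero {ξ : Dual K V} {k : ℕ} (v : Fin k → V) (h : ∀ j, ξ (v j) = 0) :
    cliffordOp (0, ξ) (ExteriorAlgebra.ιMulti K k v) = 0 := by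
  induction k with
  | zero => simp [cliffordOp_apply, CliffordAlgebra.contractLeft_one]
  | succ k ih =>
    rw [ExteriorAlgebra.ιMulti_succ_apply, ← cliffordOp_vector, cliffordOp_anticomm,
      ih (Matrix.vecTail v) fun j => h j.succ]
    simp [hyperbolicPairing, h]

theorem wedge_ιMulti_eq_zero {k : ℕ} (v : Fin k → V) (j : Fin k) :
    cliffordOp (v j, (0 : Dual K V)) (ExteriorAlgebra.ιMulti K k v) = 0 := by
  rw [cliffordOp_vector, ExteriorAlgebra.ιMulti_apply, ExteriorAlgebra.ι_mul_prod_list]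

theorem span_ιMulti_basis {ι : Type*} (b : Basis ι K V) :
    Submodule.span K {z : ExteriorAlgebra K V |
      ∃ (k : ℕ) (x : Fin k → ι), ExteriorAlgebra.ιMulti K k (fun i => b (x i)) = z} = ⊤ := by
  set N := Submodule.span K {z : ExteriorAlgebra K V |
      ∃ (k : ℕ) (x : Fin k → ι), ExteriorAlgebra.ιMulti K k (fun i => b (x i)) = z} with hN
  have h1 : (1 : ExteriorAlgebra K V) ∈ N :=
    Submodule.subset_span ⟨0, Fin.elim0, by simp⟩
  have hb : ∀ i, ∀ x ∈ N, ExteriorAlgebra.ι K (b i) * x ∈ N := by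
    intro i x hx
    induction hx using Submodule.span_induction with
    | mem x hx =>
      obtain ⟨k, y, rfl⟩ := hx
      refine Submodule.subset_span ⟨k + 1, Fin.cons i y, ?_⟩
      rw [ExteriorAlgebra.ιMulti_succ_apply]
      rfl
    | zero => simp
    | add x y _ _ hx hy => rw [mul_add]; exact add_mem hx hy
    | smul c x _ hx => rw [mul_smul_comm]; exact N.smul_mem c hx
  rw [Submodule.eq_top_iff']
  intro x
  induction x using CliffordAlgebra.left_induction with
  | algebraMap r => rw [Algebra.algebraMap_eq_smul_one]; exact N.smul_mem r h1
  | add x y hx hy => exact add_mem hx hy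
  | ι_mul x m hx =>
    change ExteriorAlgebra.ι K m * x ∈ N
    induction b.mem_span m using Submodule.span_induction with
    | mem m hm => obtain ⟨i, rfl⟩ := hm; exact hb i x hx
    | zero => simp
    | add x y _ _ hx hy => rw [map_add, add_mul]; exact add_mem hx hy
    | smul c x _ hx => rw [map_smul, smul_mul_assoc]; exact N.smul_mem c hx

theorem ιMulti_mem_span_of_range_eq {ι : Type*} (b : ι → V) {k m : ℕ} {x : Fin k → ι}
    {y : Fin m → ι} (hx : Function.Injective x) (hy : Function.Injective y)
    (hxy : Set.range x = Set.range y) :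
    ∃ c : K, ExteriorAlgebra.ιMulti K k (fun i => b (x i)) =
      c • ExteriorAlgebra.ιMulti K m (fun i => b (y i)) := by
  let e : Fin k ≃ Fin m :=
    (Equiv.ofInjective x hx).trans ((Equiv.setCongr hxy).trans (Equiv.ofInjective y hy).symm)
  have he : ∀ i, y (e i) = x i := by
    intro i
    simp [e, Equiv.apply_ofInjective_symm]
  obtain rfl : k = m := by simpa using Fintype.card_congr e
  refine ⟨((Equiv.Perm.sign e : ℤ) : K), ?_⟩
  have := (ExteriorAlgebra.ιMulti K k).map_perm (fun i => b (y i)) e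
  rw [Int.cast_smul_eq_zsmul, ← Units.smul_def, ← this]
  congr 1
  ext i
  simp [he]

end

/-! ### Operators compatible with a linear relation -/

noncomputable section

variable {V W Y : Type*} [AddCommGroup V] [Module ℂ V] [AddCommGroup W] [Module ℂ W]
  [AddCommGroup Y] [Module ℂ Y]

/-- The relation `V × V* ⇉ W × W*` induced by a relation `P : V ⇉ W`: vectors are related
by `P` and covectors agree along `P`. -/
def relDouble (P : Submodule ℂ (V × W)) : Set ((V × Dual ℂ V) × (W × Dual ℂ W)) :=
  {p | (p.1.1, p.2.1) ∈ P ∧ ∀ v w, (v, w) ∈ P → p.1.2 v = p.2.2 w}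

/-- `L : Λ(V) → Λ(W)` intertwines, up to the scalar `ε`, the Clifford actions along `P`
and the grading involutions. -/
structure Intertwines (P : Submodule ℂ (V × W)) (ε : ℂ)
    (L : ExteriorAlgebra ℂ V →ₗ[ℂ] ExteriorAlgebra ℂ W) : Prop where
  comm : ∀ p q, (p, q) ∈ relDouble P → ∀ x, L (cliffordOp p x) = ε • cliffordOp q (L x)
  grade : ∀ x, gradeInvolution (L x) = ε • L (gradeInvolution x)

theorem exists_mem_relDouble_of_relComp {P : Submodule ℂ (V × W)} {Q : Submodule ℂ (W × Y)}
    {p : V × Dual ℂ V} {r : Y × Dual ℂ Y} (h : (p, r) ∈ relDouble (relComp Q P)) :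
    ∃ q, (p, q) ∈ relDouble P ∧ (q, r) ∈ relDouble Q := by
  obtain ⟨⟨w, hw1, hw2⟩, h2⟩ := h
  obtain ⟨η, hη⟩ := exists_dual_comp_eq
    (((LinearMap.snd ℂ V W) ∘ₗ P.subtype).coprod (-((LinearMap.fst ℂ W Y) ∘ₗ Q.subtype)))
    ((p.2 ∘ₗ (LinearMap.fst ℂ V W) ∘ₗ P.subtype).coprod
      (-(r.2 ∘ₗ (LinearMap.snd ℂ W Y) ∘ₗ Q.subtype))) (by
      rintro ⟨⟨⟨v, w⟩, hv⟩, ⟨⟨w', y⟩, hy⟩⟩ h0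
      have h0' : w = w' := by simpa [← sub_eq_add_neg, sub_eq_zero] using h0
      subst h0'
      have := h2 v y ⟨w, hv, hy⟩
      simp [this])
  refine ⟨(w, η), ⟨hw1, fun v w' hv => ?_⟩, ⟨hw2, fun w' y hy => ?_⟩⟩
  · have := hη (⟨(v, w'), hv⟩, 0)
    simpa using this.symm
  · have := hη (0, ⟨(w', y), hy⟩)
    simpa using this

theorem Intertwines.comp {P : Submodule ℂ (V × W)} {Q : Submodule ℂ (W × Y)} {ε δ : ℂ}
    {L : ExteriorAlgebra ℂ V →ₗ[ℂ] ExteriorAlgebra ℂ W}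
    {M : ExteriorAlgebra ℂ W →ₗ[ℂ] ExteriorAlgebra ℂ Y}
    (hM : Intertwines Q δ M) (hL : Intertwines P ε L) :
    Intertwines (relComp Q P) (ε * δ) (M ∘ₗ L) where
  comm p r h x := by
    obtain ⟨q, h1, h2⟩ := exists_mem_relDouble_of_relComp h
    simp only [LinearMap.comp_apply, hL.comm _ _ h1, map_smul, hM.comm _ _ h2, smul_smul]
  grade x := by
    rw [LinearMap.comp_apply, hM.grade, hL.grade, map_smul, smul_smul, mul_comm,
      LinearMap.comp_apply]

namespace CanonicalBasisPair

variable {S : Submodule ℂ (V × W)} (c : CanonicalBasisPair S)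

/-- The linear map sending each `gⱼ` to `Gⱼ` and all `fᵢ`, `hₗ` to `0`. -/
def transfer : V →ₗ[ℂ] W :=
  c.bV.constr ℂ (Sum.elim 0 (Sum.elim (fun j => c.bW (.inr (.inl j))) 0))

/-- The operator `λ(S)` attached to a canonical basis pair. -/
def lambda : ExteriorAlgebra ℂ V →ₗ[ℂ] ExteriorAlgebra ℂ W :=
  ((wedgeList c.bW).map cliffordOp).prod ∘ₗ (ExteriorAlgebra.map c.transfer).toLinearMap ∘ₗ
    ((contractList c.bV).map cliffordOp).prod

theorem lambda_apply (x : ExteriorAlgebra ℂ V) : c.lambda x =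
    ((wedgeList c.bW).map cliffordOp).prod
      (ExteriorAlgebra.map c.transfer (((contractList c.bV).map cliffordOp).prod x)) := rfl

theorem transfer_inl (i) : c.transfer (c.bV (.inl i)) = 0 := by simp [transfer]

theorem transfer_inr_inl (j) : c.transfer (c.bV (.inr (.inl j))) = c.bW (.inr (.inl j)) := by
  simp [transfer]

theorem transfer_inr_inr (l) : c.transfer (c.bV (.inr (.inr l))) = 0 := by simp [transfer]

theorem mem_indef (i) : ((0 : V), c.bW (.inl i)) ∈ S := by
  have h := c.hspan.symm.le
  exact h (Submodule.subset_span (.inl (.inl ⟨i, rfl⟩)))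

theorem mem_graph (j) : (c.bV (.inr (.inl j)), c.bW (.inr (.inl j))) ∈ S := by
  have h := c.hspan.symm.le
  exact h (Submodule.subset_span (.inl (.inr ⟨j, rfl⟩)))

theorem mem_ker (l) : (c.bV (.inr (.inr l)), (0 : W)) ∈ S := by
  have h := c.hspan.symm.le
  exact h (Submodule.subset_span (.inr ⟨l, rfl⟩))

theorem induction {p : V × W → Prop} (h0 : p 0) (hadd : ∀ x y, p x → p y → p (x + y))
    (hsmul : ∀ (a : ℂ) x, p x → p (a • x)) (hF : ∀ i, p (0, c.bW (.inl i)))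
    (hG : ∀ j, p (c.bV (.inr (.inl j)), c.bW (.inr (.inl j))))
    (hH : ∀ l, p (c.bV (.inr (.inr l)), 0)) {x : V × W} (hx : x ∈ S) : p x := by
  have h := c.hspan.le hx
  clear hx
  induction h using Submodule.span_induction with
  | mem x hx => rcases hx with (⟨i, rfl⟩ | ⟨i, rfl⟩) | ⟨i, rfl⟩; exacts [hF i, hG i, hH i]
  | zero => exact h0
  | add x y _ _ h1 h2 => exact hadd x y h1 h2
  | smul a x _ h1 => exact hsmul a x h1

theorem coord_inl_eq_zero {x : V × W} (hx : x ∈ S) (i) : c.bV.coord (.inl i) x.1 = 0 := by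
  refine c.induction (p := fun x => c.bV.coord (.inl i) x.1 = 0) ?_ ?_ ?_ ?_ ?_ ?_ hx <;>
    simp +contextual

theorem sub_transfer_mem {x : V × W} (hx : x ∈ S) :
    x.2 - c.transfer x.1 ∈ Submodule.span ℂ (Set.range fun i => c.bW (.inl i)) := by
  refine c.induction (p := fun x => x.2 - c.transfer x.1 ∈
    Submodule.span ℂ (Set.range fun i => c.bW (.inl i))) ?_ ?_ ?_ ?_ ?_ ?_ hx
  · simp
  · intro x y hx hy
    have := add_mem hx hy
    rwa [← add_sub_add_comm, ← map_add] at this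
  · intro a x hx
    have := Submodule.smul_mem _ a hx
    rwa [smul_sub, ← map_smul] at this
  · intro i
    rw [map_zero, sub_zero]
    exact Submodule.subset_span ⟨i, rfl⟩
  · simp [transfer_inr_inl]
  · simp [transfer_inr_inr]

theorem sub_transfer_dual_mem {ξ : Dual ℂ V} {η : Dual ℂ W}
    (h : ∀ v w, (v, w) ∈ S → ξ v = η w) :
    ξ - η ∘ₗ c.transfer ∈ Submodule.span ℂ (Set.range fun i => c.bV.coord (.inl i)) := by
  have : ξ - η ∘ₗ c.transfer = ∑ i, ξ (c.bV (.inl i)) • c.bV.coord (.inl i) := by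
    refine c.bV.ext ?_
    rintro (i | j | l)
    · simp [transfer_inl, Finsupp.single_apply]
    · simp [transfer_inr_inl, h _ _ (c.mem_graph j)]
    · simp [transfer_inr_inr, h _ _ (c.mem_ker l)]
  rw [this]
  exact sum_mem fun i _ => Submodule.smul_mem _ _ (Submodule.subset_span ⟨i, rfl⟩)

theorem map_cliffordOp (v : V) (η : Dual ℂ W) (x : ExteriorAlgebra ℂ V) :
    ExteriorAlgebra.map c.transfer (cliffordOp (v, η ∘ₗ c.transfer) x) =
      cliffordOp (c.transfer v, η) (ExteriorAlgebra.map c.transfer x) := by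
  simp only [cliffordOp_apply, map_add, map_mul, ExteriorAlgebra.map_apply_ι, map_contractLeft]

theorem intertwines_lambda : Intertwines S ((-1) ^ (c.α + c.μ)) c.lambda where
  grade x := by
    rw [lambda_apply, lambda_apply, gradeInvolution_prod, gradeInvolution_map,
      gradeInvolution_prod, map_smul, map_smul, smul_smul, length_wedgeList, length_contractList,
      pow_add, mul_comm]
  comm := by
    rintro ⟨v, ξ⟩ ⟨w, η⟩ ⟨hvw, hξη⟩ x
    have hp : ((v, ξ) : V × Dual ℂ V) = (v, η ∘ₗ c.transfer) + (0, ξ - η ∘ₗ c.transfer) := by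
      ext1 <;> simp
    have hq : ((w, η) : W × Dual ℂ W) = (c.transfer v, η) + (w - c.transfer v, 0) := by
      ext1 <;> simp
    have h1 : ∀ ζ ∈ Submodule.span ℂ (Set.range fun i => c.bV.coord (.inl i)), ∀ x,
        ((contractList c.bV).map cliffordOp).prod (cliffordOp ((0 : V), ζ) x) = 0 := by
      intro ζ hζ x
      induction hζ using Submodule.span_induction with
      | mem ζ h =>
        obtain ⟨i, rfl⟩ := h
        refine prod_cliffordOp_of_mem (by simp) _ ?_ ?_ x
        · intro q hq
          obtain ⟨j, -, rfl⟩ := List.mem_map.1 (List.mem_reverse.1 hq)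
          simp [hyperbolicPairing, creat]
        · exact List.mem_reverse.2 (List.mem_map.2 ⟨i, List.mem_finRange i, rfl⟩)
      | zero => simp [← Prod.zero_eq_mk]
      | add a b _ _ ha hb =>
        rw [show ((0 : V), a + b) = (0, a) + (0, b) by simp, map_add, LinearMap.add_apply, map_add,
          ha, hb, add_zero]
      | smul t a _ ha =>
        rw [show ((0 : V), t • a) = t • (0, a) by simp, map_smul, LinearMap.smul_apply, map_smul,
          ha, smul_zero]
    have h2 : ∀ u ∈ Submodule.span ℂ (Set.range fun i => c.bW (.inl i)), ∀ x,
        cliffordOp (u, (0 : Dual ℂ W)) (((wedgeList c.bW).map cliffordOp).prod x) = 0 := by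
      intro u hu x
      induction hu using Submodule.span_induction with
      | mem u h =>
        obtain ⟨i, rfl⟩ := h
        refine cliffordOp_prod_of_mem (by simp) _ ?_ ?_ x
        · intro q hq
          obtain ⟨j, -, rfl⟩ := List.mem_map.1 hq
          simp [hyperbolicPairing, annih]
        · exact List.mem_map.2 ⟨i, List.mem_finRange i, rfl⟩
      | zero => simp [← Prod.zero_eq_mk]
      | add a b _ _ ha hb =>
        rw [show (a + b, (0 : Dual ℂ W)) = (a, 0) + (b, 0) by simp, map_add, LinearMap.add_apply,
          ha, hb, add_zero]
      | smul t a _ ha =>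
        rw [show (t • a, (0 : Dual ℂ W)) = t • (a, 0) by simp, map_smul, LinearMap.smul_apply,
          ha, smul_zero]
    have hC := cliffordOp_prod_anticomm (v, η ∘ₗ c.transfer) (contractList c.bV) (fun q hq => by
      obtain ⟨j, -, rfl⟩ := List.mem_map.1 (List.mem_reverse.1 hq)
      have := c.coord_inl_eq_zero hvw j
      simpa [hyperbolicPairing, creat] using this) x
    have hE := cliffordOp_prod_anticomm (c.transfer v, η) (wedgeList c.bW) (fun q hq => by
      obtain ⟨j, -, rfl⟩ := List.mem_map.1 hq
      have := hξη _ _ (c.mem_indef j)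
      simpa [hyperbolicPairing, annih] using this.symm)
      (ExteriorAlgebra.map c.transfer (((contractList c.bV).map cliffordOp).prod x))
    rw [hp, hq, map_add, map_add, LinearMap.add_apply, LinearMap.add_apply, map_add,
      lambda_apply, lambda_apply, lambda_apply, h1 _ (c.sub_transfer_dual_mem hξη),
      h2 _ (c.sub_transfer_mem hvw), hC, map_smul, map_smul, map_cliffordOp, hE, smul_smul,
      length_contractList, length_wedgeList, pow_add]
    simp

theorem lambda_good (s : Finset (Fin c.β)) :
    c.lambda (ExteriorAlgebra.ιMulti ℂ _ (goodTupleV c s)) =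
      ExteriorAlgebra.ιMulti ℂ _ (goodTupleW c s) := by
  have hV := ExteriorAlgebra.ιMulti_mul_ιMulti (R := ℂ) (fun i => c.bV (.inl i))
    (fun j => c.bV (.inr (.inl ((s.orderIsoOfFin rfl j : s) : Fin c.β))))
  have hW := ExteriorAlgebra.ιMulti_mul_ιMulti (R := ℂ) (fun i => c.bW (.inl i))
    (fun j => c.bW (.inr (.inl ((s.orderIsoOfFin rfl j : s) : Fin c.β))))
  rw [← wedge_eq_ιMulti_mul] at hV hW
  refine (congrArg c.lambda hV.symm).trans (Eq.trans ?_ hW)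
  rw [lambda_apply, contract_wedge, ExteriorAlgebra.map_apply_ιMulti]
  · congr 3
    ext j
    exact c.transfer_inr_inl _
  · intro i
    exact contract_ιMulti_eq_zero _ fun j => by simp

theorem lambda_bad (k : ℕ) (x : Fin k → (Fin c.α ⊕ Fin c.β ⊕ Fin c.γ))
    (hx : (∃ i : Fin c.α, Sum.inl i ∉ Set.range x) ∨
      (∃ l : Fin c.γ, Sum.inr (Sum.inr l) ∈ Set.range x)) :
    c.lambda (ExteriorAlgebra.ιMulti ℂ k (fun i => c.bV (x i))) = 0 := by
  set z := ExteriorAlgebra.ιMulti ℂ k (fun i => c.bV (x i)) with hz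
  rcases hx with ⟨i, hi⟩ | ⟨l, j, hl⟩
  · have h0 : cliffordOp ((0 : V), c.bV.coord (.inl i)) z = 0 := by
      refine contract_ιMulti_eq_zero _ fun j => ?_
      rw [Basis.coord_apply, Basis.repr_self, Finsupp.single_eq_of_ne]
      exact fun h => hi ⟨j, h.symm⟩
    have h1 := cliffordOp_anticomm ((0 : V), c.bV.coord (.inl i)) (c.bV (.inl i), 0) z
    rw [h0, map_zero, sub_zero] at h1
    have h2 : ((((0 : V), c.bV.coord (.inl i)), (0 : W × Dual ℂ W))) ∈ relDouble S :=
      ⟨S.zero_mem, fun v w h => c.coord_inl_eq_zero h i⟩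
    have h3 := c.intertwines_lambda.comm _ _ h2 (cliffordOp (c.bV (.inl i), 0) z)
    rw [h1] at h3
    simpa [hyperbolicPairing] using h3
  · have h0 : cliffordOp (c.bV (.inr (.inr l)), (0 : Dual ℂ V)) z = 0 := by
      rw [← hl]
      exact wedge_ιMulti_eq_zero (fun i => c.bV (x i)) j
    have h1 := cliffordOp_anticomm (c.bV (.inr (.inr l)), 0)
      ((0 : V), c.bV.coord (.inr (.inr l))) z
    rw [h0, map_zero, sub_zero] at h1
    have h2 : ((c.bV (.inr (.inr l)), (0 : Dual ℂ V)), (0 : W × Dual ℂ W)) ∈ relDouble S :=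
      ⟨c.mem_ker l, fun v w h => rfl⟩
    have h3 := c.intertwines_lambda.comm _ _ h2
      (cliffordOp ((0 : V), c.bV.coord (.inr (.inr l))) z)
    rw [h1] at h3
    simpa [hyperbolicPairing] using h3

theorem exists_good_of_not_bad {k : ℕ} {x : Fin k → (Fin c.α ⊕ Fin c.β ⊕ Fin c.γ)}
    (hinj : Function.Injective x)
    (hx : ¬ ((∃ i : Fin c.α, Sum.inl i ∉ Set.range x) ∨
      (∃ l : Fin c.γ, Sum.inr (Sum.inr l) ∈ Set.range x))) :
    ∃ (s : Finset (Fin c.β)) (a : ℂ), ExteriorAlgebra.ιMulti ℂ k (fun i => c.bV (x i)) =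
      a • ExteriorAlgebra.ιMulti ℂ _ (goodTupleV c s) := by
  classical
  push Not at hx
  let s : Finset (Fin c.β) := Finset.univ.filter fun j => Sum.inr (Sum.inl j) ∈ Set.range x
  let y : Fin (c.α + s.card) → Fin c.α ⊕ Fin c.β ⊕ Fin c.γ :=
    Fin.addCases (fun i => .inl i) fun j => .inr (.inl ((s.orderIsoOfFin rfl j : s) : Fin c.β))
  have hy : goodTupleV c s = fun i => c.bV (y i) := by
    ext i
    refine Fin.addCases (fun i => ?_) (fun i => ?_) i <;> simp [goodTupleV, y]
  have hyinj : Function.Injective y := by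
    intro i j
    refine Fin.addCases (fun i => ?_) (fun i => ?_) i <;>
      refine Fin.addCases (fun j => ?_) (fun j => ?_) j <;> simp [y]
  have hrange : Set.range x = Set.range y := by
    ext t
    constructor
    · intro ht
      rcases t with i | j | l
      · exact ⟨Fin.castAdd _ i, by simp [y]⟩
      · have hj : j ∈ s := by simpa [s] using ht
        refine ⟨Fin.natAdd _ ((s.orderIsoOfFin rfl).symm ⟨j, hj⟩), ?_⟩
        simp only [y, Fin.addCases_right, OrderIso.apply_symm_apply]
      · exact absurd ht (hx.2 l)
    · rintro ⟨i, rfl⟩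
      refine Fin.addCases (fun i => ?_) (fun i => ?_) i
      · simpa [y] using hx.1 i
      · have := (Finset.mem_filter.1 (s.orderIsoOfFin rfl i).2).2
        simpa only [y, Fin.addCases_right] using this
  obtain ⟨a, ha⟩ := ιMulti_mem_span_of_range_eq (K := ℂ) c.bV hinj hyinj hrange
  exact ⟨s, a, by rw [ha, hy]⟩

theorem eq_lambda {L : ExteriorAlgebra ℂ V →ₗ[ℂ] ExteriorAlgebra ℂ W} (hL : IsLambda c L) :
    L = c.lambda := by
  refine LinearMap.ext_on (span_ιMulti_basis c.bV) ?_
  rintro _ ⟨k, x, rfl⟩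
  by_cases hinj : Function.Injective x
  · by_cases hx : (∃ i : Fin c.α, Sum.inl i ∉ Set.range x) ∨
      (∃ l : Fin c.γ, Sum.inr (Sum.inr l) ∈ Set.range x)
    · rw [hL.2 k x hx, c.lambda_bad k x hx]
    · obtain ⟨s, a, h⟩ := c.exists_good_of_not_bad hinj hx
      rw [h, map_smul, map_smul, hL.1, c.lambda_good]
  · rw [ExteriorAlgebra.ιMulti_eq_zero_of_not_inj, map_zero, map_zero]
    exact fun h => hinj h.of_comp

theorem lambda_vacuum : c.lambda (vacuum c.bV) = vacuum c.bW := by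
  rw [lambda_apply, vacuum, contract_wedge, map_one, vacuum]
  intro i
  simp [cliffordOp_apply, creat, CliffordAlgebra.contractLeft_one]

theorem exists_creat_mem (i) : ∃ q, (creat c.bV i, q) ∈ relDouble S := by
  rcases i with i | j | l
  · exact ⟨(0, 0), S.zero_mem, fun v w h => c.coord_inl_eq_zero h i⟩
  · exact ⟨(c.bW (.inr (.inl j)), 0), c.mem_graph j, fun v w h => rfl⟩
  · exact ⟨(0, 0), c.mem_ker l, fun v w h => rfl⟩

theorem coord_inr_inl_eq {x : V × W} (hx : x ∈ S) (j) :
    c.bV.coord (.inr (.inl j)) x.1 = c.bW.coord (.inr (.inl j)) x.2 := by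
  refine c.induction
    (p := fun x => c.bV.coord (.inr (.inl j)) x.1 = c.bW.coord (.inr (.inl j)) x.2)
    ?_ ?_ ?_ ?_ ?_ ?_ hx <;> simp +contextual [Finsupp.single_apply]

theorem coord_inr_inr_eq_zero {x : V × W} (hx : x ∈ S) (l) :
    c.bW.coord (.inr (.inr l)) x.2 = 0 := by
  refine c.induction (p := fun x => c.bW.coord (.inr (.inr l)) x.2 = 0)
    ?_ ?_ ?_ ?_ ?_ ?_ hx <;> simp +contextual

theorem exists_annih_mem (i) : ∃ p, (p, annih c.bW i) ∈ relDouble S ∧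
    cliffordOp p (vacuum c.bV) = 0 := by
  rcases i with i | j | l
  · exact ⟨(0, 0), ⟨c.mem_indef i, fun v w h => rfl⟩, by simp [← Prod.zero_eq_mk]⟩
  · exact ⟨(0, c.bV.coord (.inr (.inl j))), ⟨S.zero_mem, fun v w h => c.coord_inr_inl_eq h j⟩,
      annih_vacuum c.bV (.inr (.inl j))⟩
  · exact ⟨(0, 0), ⟨S.zero_mem, fun v w h => (c.coord_inr_inr_eq_zero h l).symm⟩,
      by simp [← Prod.zero_eq_mk]⟩

/-- An intertwining operator is determined by its value on the vacuum. -/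
theorem eq_zero_of_intertwines {ε : ℂ} {L : ExteriorAlgebra ℂ V →ₗ[ℂ] ExteriorAlgebra ℂ W}
    (hL : Intertwines S ε L) (h0 : L (vacuum c.bV) = 0) : L = 0 := by
  rw [← LinearMap.ker_eq_top]
  refine eq_top_of_vacuum_mem c.bV _ ?_ h0
  rintro _ ⟨i, rfl⟩ x hx
  obtain ⟨q, hq⟩ := c.exists_creat_mem i
  rw [LinearMap.mem_ker] at hx ⊢
  rw [hL.comm _ _ hq, hx, map_zero, smul_zero]

theorem gradeInvolution_vacuum {n : ℕ} {κ : Type*} (b : Basis (Fin n ⊕ κ) ℂ V) :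
    gradeInvolution (vacuum b) = (-1 : ℂ) ^ n • vacuum b := by
  rw [vacuum, gradeInvolution_prod, gradeInvolution_one, length_wedgeList]

/-- A nonzero intertwining operator is a nonzero multiple of `λ(S)`. -/
theorem exists_eq_smul_of_intertwines {ε : ℂ} (hε : ε ≠ 0)
    {L : ExteriorAlgebra ℂ V →ₗ[ℂ] ExteriorAlgebra ℂ W} (hL : Intertwines S ε L) (hL0 : L ≠ 0) :
    ∃ a : ℂ, a ≠ 0 ∧ L = a • c.lambda := by
  have hmem : L (vacuum c.bV) ∈ Submodule.span ℂ {vacuum c.bW} := by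
    refine mem_span_vacuum _ _ fun i => ?_
    obtain ⟨p, hp, hp0⟩ := c.exists_annih_mem i
    have := hL.comm _ _ hp (vacuum c.bV)
    rw [hp0, map_zero, eq_comm, smul_eq_zero] at this
    exact this.resolve_left hε
  obtain ⟨a, ha⟩ := Submodule.mem_span_singleton.1 hmem
  have ha0 : a ≠ 0 := by
    rintro rfl
    exact hL0 (c.eq_zero_of_intertwines hL (by rw [← ha, zero_smul]))
  have hsign : ε = (-1) ^ (c.α + c.μ) := by
    have h := hL.grade (vacuum c.bV)
    rw [gradeInvolution_vacuum, map_smul, ← ha, map_smul, gradeInvolution_vacuum, smul_smul,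
      smul_smul, smul_smul] at h
    have h' := smul_left_injective ℂ (vacuum_ne_zero c.bW) h
    have h2 : (-1 : ℂ) ^ c.μ = ε * (-1) ^ c.α := by
      refine mul_left_cancel₀ ha0 ?_
      rw [h']
      ring
    rw [pow_add, h2, mul_comm, mul_assoc, ← mul_pow]
    simp
  refine ⟨a, ha0, sub_eq_zero.1 (c.eq_zero_of_intertwines (ε := ε) ⟨fun p q h x => ?_,
    fun x => ?_⟩ ?_)⟩
  · have := (c.intertwines_lambda.comm p q h x)
    rw [← hsign] at this
    simp only [LinearMap.sub_apply, LinearMap.smul_apply, hL.comm p q h x, this, map_sub,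
      map_smul, smul_sub, smul_comm a ε]
  · have := (c.intertwines_lambda.grade x)
    rw [← hsign] at this
    simp only [LinearMap.sub_apply, LinearMap.smul_apply, hL.grade x, this, map_sub,
      map_smul, smul_sub, smul_comm a ε]
  · rw [LinearMap.sub_apply, LinearMap.smul_apply, lambda_vacuum, ha, sub_self]

end CanonicalBasisPair

/-- If the pair is not transversal, some nonzero `q` is both in the indefiniteness of the
double of `P` and in the kernel of the double of `Q`. -/
theorem exists_mem_relDouble_of_not_transversal {P : Submodule ℂ (V × W)}
    {Q : Submodule ℂ (W × Y)} (h : ¬ Transversal Q P) :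
    ∃ q r : W × Dual ℂ W, hyperbolicPairing q r = 1 ∧ (0, q) ∈ relDouble P ∧
      (q, 0) ∈ relDouble Q := by
  rw [Transversal, not_and_or] at h
  rcases h with h | h
  · obtain ⟨η, hη0, hη⟩ := Submodule.exists_le_ker_of_lt_top _ (lt_top_iff_ne_top.2 h)
    obtain ⟨w, hw⟩ := DFunLike.exists_ne hη0
    rw [LinearMap.zero_apply] at hw
    refine ⟨(0, η), ((η w)⁻¹ • w, 0), ?_, ⟨P.zero_mem, fun v w h => ?_⟩,
      ⟨Q.zero_mem, fun w y h => ?_⟩⟩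
    · simp [hyperbolicPairing, hw]
    · exact (hη (Submodule.mem_sup_left ⟨(v, w), h, rfl⟩)).symm
    · exact hη (Submodule.mem_sup_right ⟨(w, y), h, rfl⟩)
  · obtain ⟨w, ⟨hw1, hw2⟩, hw0⟩ := Submodule.exists_mem_ne_zero_of_ne_bot h
    obtain ⟨ξ, hξ⟩ := Module.Projective.exists_dual_ne_zero ℂ hw0
    refine ⟨(w, 0), (0, (ξ w)⁻¹ • ξ), ?_, ⟨hw1, fun v w h => rfl⟩, ⟨hw2, fun w y h => rfl⟩⟩
    simp [hyperbolicPairing, hξ]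

theorem comp_eq_zero_of_not_transversal {P : Submodule ℂ (V × W)} {Q : Submodule ℂ (W × Y)}
    {ε δ : ℂ} {L : ExteriorAlgebra ℂ V →ₗ[ℂ] ExteriorAlgebra ℂ W}
    {M : ExteriorAlgebra ℂ W →ₗ[ℂ] ExteriorAlgebra ℂ Y} (hL : Intertwines P ε L) (hε : ε ≠ 0)
    (hM : Intertwines Q δ M) (h : ¬ Transversal Q P) : M ∘ₗ L = 0 := by
  obtain ⟨q, r, hqr, hP, hQ⟩ := exists_mem_relDouble_of_not_transversal h
  refine LinearMap.ext fun x => ?_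
  have h1 := hL.comm _ _ hP x
  rw [map_zero, LinearMap.zero_apply, map_zero, eq_comm, smul_eq_zero] at h1
  have h2 := cliffordOp_anticomm q r (L x)
  rw [hqr, one_smul, h1.resolve_left hε, map_zero, sub_zero] at h2
  rw [LinearMap.comp_apply, ← h2, hM.comm _ _ hQ]
  simp

theorem span_relDouble_of_transversal {P : Submodule ℂ (V × W)} {Q : Submodule ℂ (W × Y)}
    (h : Transversal Q P) :
    Submodule.span ℂ ({q : W × Dual ℂ W | ∃ p, (p, q) ∈ relDouble P} ∪
      {q | ∃ r, (q, r) ∈ relDouble Q}) = ⊤ := by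
  rw [Submodule.eq_top_iff']
  rintro ⟨w, θ⟩
  obtain ⟨_, ⟨⟨v, w₁⟩, hv, rfl⟩, _, ⟨⟨w₂, y⟩, hy, rfl⟩, hw⟩ :=
    Submodule.mem_sup.1 (h.1 ▸ Submodule.mem_top : w ∈ relIm P ⊔ relDom Q)
  have hθ : θ ∈ (relIndef P).dualAnnihilator ⊔ (relKer Q).dualAnnihilator := by
    rw [← Subspace.dualAnnihilator_inf_eq, h.2, Submodule.dualAnnihilator_bot]
    exact Submodule.mem_top
  obtain ⟨η₁, hη₁, η₂, hη₂, rfl⟩ := Submodule.mem_sup.1 hθ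
  rw [Submodule.mem_dualAnnihilator] at hη₁ hη₂
  obtain ⟨ξ, hξ⟩ := exists_dual_comp_eq (LinearMap.fst ℂ V W ∘ₗ P.subtype)
    (η₁ ∘ₗ LinearMap.snd ℂ V W ∘ₗ P.subtype) (by
      rintro ⟨⟨v, w⟩, h⟩ (rfl : v = 0)
      exact hη₁ w h)
  obtain ⟨ζ, hζ⟩ := exists_dual_comp_eq (LinearMap.snd ℂ W Y ∘ₗ Q.subtype)
    (η₂ ∘ₗ LinearMap.fst ℂ W Y ∘ₗ Q.subtype) (by
      rintro ⟨⟨w, y⟩, h⟩ (rfl : y = 0)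
      exact hη₂ w h)
  have : (w, η₁ + η₂) = (w₁, η₁) + (w₂, η₂) := by
    rw [Prod.mk_add_mk, ← hw]
    rfl
  rw [this]
  refine add_mem (Submodule.subset_span (.inl ⟨(v, ξ), hv, fun v w h => hξ ⟨(v, w), h⟩⟩))
    (Submodule.subset_span (.inr ⟨(y, ζ), hy, fun w y h => (hζ ⟨(w, y), h⟩).symm⟩))

theorem lambda_comp_ne_zero_of_transversal {P : Submodule ℂ (V × W)} {Q : Submodule ℂ (W × Y)}
    (cP : CanonicalBasisPair P) (cQ : CanonicalBasisPair Q) (h : Transversal Q P) :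
    cQ.lambda ∘ₗ cP.lambda ≠ 0 := by
  intro h0
  have htop : LinearMap.ker cQ.lambda = ⊤ := by
    refine eq_top_of_cliffordStable (span_relDouble_of_transversal h)
      (R := LinearMap.range cP.lambda) ?_ ?_ (LinearMap.range_le_ker_iff.2 h0)
      ⟨_, cP.lambda_vacuum⟩ (one_mem_of_vacuum_mem cP.bW)
    · rintro q ⟨p, hp⟩ _ ⟨x, rfl⟩
      have := cP.intertwines_lambda.comm _ _ hp x
      refine ⟨((-1 : ℂ) ^ (cP.α + cP.μ))⁻¹ • cliffordOp p x, ?_⟩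
      rw [map_smul, this, inv_smul_smul₀ (by simp)]
    · rintro q ⟨r, hr⟩ x hx
      rw [LinearMap.mem_ker] at hx ⊢
      rw [cQ.intertwines_lambda.comm _ _ hr, hx, map_zero, smul_zero]
  have : vacuum cQ.bV ∈ LinearMap.ker cQ.lambda := htop ▸ Submodule.mem_top
  rw [LinearMap.mem_ker, cQ.lambda_vacuum] at this
  exact vacuum_ne_zero _ this

end

theorem lambda_comp_lambda
    {V W Y : Type*} [AddCommGroup V] [Module ℂ V] [AddCommGroup W] [Module ℂ W]
    [AddCommGroup Y] [Module ℂ Y]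
    [FiniteDimensional ℂ V] [FiniteDimensional ℂ W] [FiniteDimensional ℂ Y]
    (P : Submodule ℂ (V × W)) (Q : Submodule ℂ (W × Y))
    (cP : CanonicalBasisPair P) (LP : ExteriorAlgebra ℂ V →ₗ[ℂ] ExteriorAlgebra ℂ W)
    (hLP : IsLambda cP LP)
    (cQ : CanonicalBasisPair Q) (LQ : ExteriorAlgebra ℂ W →ₗ[ℂ] ExteriorAlgebra ℂ Y)
    (hLQ : IsLambda cQ LQ) :
    (Transversal Q P →
      ∀ (cQP : CanonicalBasisPair (relComp Q P))
        (LQP : ExteriorAlgebra ℂ V →ₗ[ℂ] ExteriorAlgebra ℂ Y), IsLambda cQP LQP →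
          ∃ c : ℂ, c ≠ 0 ∧ LQ ∘ₗ LP = c • LQP) ∧
    (¬ Transversal Q P → LQ ∘ₗ LP = 0) := by
  obtain rfl := cP.eq_lambda hLP
  obtain rfl := cQ.eq_lambda hLQ
  refine ⟨fun h cQP LQP hLQP => ?_, fun h => ?_⟩
  · obtain rfl := cQP.eq_lambda hLQP
    exact cQP.exists_eq_smul_of_intertwines (by simp)
      (cQ.intertwines_lambda.comp cP.intertwines_lambda)
      (lambda_comp_ne_zero_of_transversal cP cQ h)
  · exact comp_eq_zero_of_not_transversal cP.intertwines_lambda (by simp)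
      cQ.intertwines_lambda h
end

section
/- Let (P_1,…,P_k) be a hinge on an n-dimensional complex vector space V. Then V ⊋ Ker P_1 ⊋ Ker P_2 ⊋ … ⊋ Ker P_k = 0 is a strictly decreasing chain of subspaces; consequently, k ≤ n. -/
open Module

/-- `(P 0, …, P (k-1))` is a hinge on `V` (with `n = dim V`): each `P j` is a linear relation
`V ⇉ V` of dimension `n`, consecutive terms satisfy `Ker P_j = Dom P_{j+1}` and
`Im P_j = Indef P_{j+1}`, the first term satisfies `Dom P_1 = V`, the last term satisfies
`Im P_k = V`, and every term has positive rank. -/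
structure IsHinge {V : Type*} [AddCommGroup V] [Module ℂ V]
    {k : ℕ} (P : Fin k → Submodule ℂ (V × V)) : Prop where
  pos : 0 < k
  dim_eq : ∀ j, Module.finrank ℂ (P j) = Module.finrank ℂ V
  ker_eq_dom : ∀ (j : ℕ) (h : j + 1 < k), relKer (P ⟨j, by omega⟩) = relDom (P ⟨j + 1, h⟩)
  im_eq_indef : ∀ (j : ℕ) (h : j + 1 < k), relIm (P ⟨j, by omega⟩) = relIndef (P ⟨j + 1, h⟩)
  dom_first : relDom (P ⟨0, pos⟩) = ⊤
  im_last : relIm (P ⟨k - 1, by omega⟩) = ⊤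
  rk_pos : ∀ j, Module.finrank ℂ (relKer (P j)) + Module.finrank ℂ (relIndef (P j)) <
    Module.finrank ℂ (P j)

section

variable {V W : Type*} [AddCommGroup V] [Module ℂ V] [AddCommGroup W] [Module ℂ W]

theorem finrank_relDom_add_finrank_relIndef [FiniteDimensional ℂ V] [FiniteDimensional ℂ W]
    (P : Submodule ℂ (V × W)) :
    finrank ℂ (relDom P) + finrank ℂ (relIndef P) = finrank ℂ P := by
  let f := (LinearMap.fst ℂ V W).domRestrict P
  have hrange : LinearMap.range f = relDom P := LinearMap.range_domRestrict _ _
  have hker : (LinearMap.ker f).map P.subtype = (relIndef P).map (LinearMap.inr ℂ V W) := by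
    ext ⟨v, w⟩
    simp only [f, relIndef, Submodule.mem_map, LinearMap.mem_ker, Submodule.mem_comap]
    constructor
    · rintro ⟨⟨⟨a, b⟩, hab⟩, h0, h1⟩
      obtain rfl : a = 0 := h0
      exact ⟨b, hab, h1⟩
    · rintro ⟨b, hb, h1⟩
      exact ⟨⟨_, hb⟩, rfl, h1⟩
  have e₁ := (Submodule.equivMapOfInjective P.subtype P.injective_subtype
    (LinearMap.ker f)).finrank_eq
  have e₂ := (Submodule.equivMapOfInjective (LinearMap.inr ℂ V W) LinearMap.inr_injective
    (relIndef P)).finrank_eq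
  rw [← f.finrank_range_add_finrank_ker, hrange, e₁, hker, e₂]

theorem finrank_relIm_add_finrank_relKer [FiniteDimensional ℂ V] [FiniteDimensional ℂ W]
    (P : Submodule ℂ (V × W)) :
    finrank ℂ (relIm P) + finrank ℂ (relKer P) = finrank ℂ P := by
  let f := (LinearMap.snd ℂ V W).domRestrict P
  have hrange : LinearMap.range f = relIm P := LinearMap.range_domRestrict _ _
  have hker : (LinearMap.ker f).map P.subtype = (relKer P).map (LinearMap.inl ℂ V W) := by
    ext ⟨v, w⟩
    simp only [f, relKer, Submodule.mem_map, LinearMap.mem_ker, Submodule.mem_comap]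
    constructor
    · rintro ⟨⟨⟨a, b⟩, hab⟩, h0, h1⟩
      obtain rfl : b = 0 := h0
      exact ⟨a, hab, h1⟩
    · rintro ⟨a, ha, h1⟩
      exact ⟨⟨_, ha⟩, rfl, h1⟩
  have e₁ := (Submodule.equivMapOfInjective P.subtype P.injective_subtype
    (LinearMap.ker f)).finrank_eq
  have e₂ := (Submodule.equivMapOfInjective (LinearMap.inl ℂ V W) LinearMap.inl_injective
    (relKer P)).finrank_eq
  rw [← f.finrank_range_add_finrank_ker, hrange, e₁, hker, e₂]

theorem relKer_le_relDom (P : Submodule ℂ (V × W)) : relKer P ≤ relDom P :=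
  fun v hv => ⟨(v, 0), hv, rfl⟩

/-- A linear relation of positive rank has kernel strictly smaller than its domain. -/
theorem relKer_lt_relDom [FiniteDimensional ℂ V] [FiniteDimensional ℂ W]
    {P : Submodule ℂ (V × W)}
    (hP : finrank ℂ (relKer P) + finrank ℂ (relIndef P) < finrank ℂ P) :
    relKer P < relDom P := by
  refine lt_of_le_of_ne (relKer_le_relDom P) fun h => ?_
  rw [h, finrank_relDom_add_finrank_relIndef] at hP
  exact hP.false

end

theorem hinge_ker_chain
    {V : Type*} [AddCommGroup V] [Module ℂ V] [FiniteDimensional ℂ V]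
    {n k : ℕ} (hn : finrank ℂ V = n)
    (P : Fin k → Submodule ℂ (V × V)) (h : IsHinge P) :
    relKer (P ⟨0, h.pos⟩) < ⊤ ∧
    (∀ (j : ℕ) (hj : j + 1 < k),
      relKer (P ⟨j + 1, hj⟩) < relKer (P ⟨j, by omega⟩)) ∧
    relKer (P ⟨k - 1, Nat.sub_lt h.pos Nat.one_pos⟩) = ⊥ ∧
    k ≤ n := by
  have hfirst : relKer (P ⟨0, h.pos⟩) < ⊤ := h.dom_first ▸ relKer_lt_relDom (h.rk_pos _)
  have hstep (j : ℕ) (hj : j + 1 < k) :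
      relKer (P ⟨j + 1, hj⟩) < relKer (P ⟨j, by omega⟩) :=
    h.ker_eq_dom j hj ▸ relKer_lt_relDom (h.rk_pos _)
  refine ⟨hfirst, hstep, ?_, ?_⟩
  · have hdim := finrank_relIm_add_finrank_relKer (P ⟨k - 1, Nat.sub_lt h.pos Nat.one_pos⟩)
    rw [h.im_last, h.dim_eq, finrank_top] at hdim
    exact Submodule.finrank_eq_zero.mp (by omega)
  · have hbound (j : ℕ) (hj : j < k) : finrank ℂ (relKer (P ⟨j, hj⟩)) + (j + 1) ≤ n := by
      induction j with
      | zero =>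
        have := Submodule.finrank_lt hfirst.ne
        omega
      | succ j ih =>
        have := Submodule.finrank_lt_finrank_of_lt (hstep j hj)
        have := ih (by omega)
        omega
    have := hbound (k - 1) (Nat.sub_lt h.pos Nat.one_pos)
    omega
end

section
/- Let V be a finite-dimensional complex vector space and A, B: V → V linear operators; write graph A = {(v, Av) : v ∈ V} ⊆ V ⊕ V and (graph B)^□ = {(Bv, v) : v ∈ V} ⊆ V ⊕ V. Then the pair (graph A, (graph B)^□) is a hinge if and only if Im A = Ker B, Ker A = Im B, A ≠ 0 and B ≠ 0. Conversely, every hinge consisting of two terms has this form: if (P_1, P_2) is a hinge on V, then there exist linear operators A, B: V → V with Im A = Ker B, Ker A = Im B, A ≠ 0, B ≠ 0, P_1 = graph A and P_2 = (graph B)^□. -/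
open Module

/-- The pseudoinverse `(graph B)^□ = {(Bv, v) : v ∈ V}` of the graph of `B`. -/
noncomputable def graphPseudoInv {V : Type*} [AddCommGroup V] [Module ℂ V]
    (B : V →ₗ[ℂ] V) : Submodule ℂ (V × V) :=
  (LinearMap.graph B).map (LinearEquiv.prodComm ℂ V V).toLinearMap

section LinearRelation

variable {V W : Type*} [AddCommGroup V] [Module ℂ V] [AddCommGroup W] [Module ℂ W]

@[simp]
theorem mem_graphPseudoInv (B : V →ₗ[ℂ] V) (p : V × V) :
    p ∈ graphPseudoInv B ↔ p.1 = B p.2 := by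
  unfold graphPseudoInv
  constructor
  · rintro ⟨⟨a, b⟩, h, rfl⟩
    exact h
  · intro h
    exact ⟨(p.2, p.1), h, rfl⟩

theorem finrank_graph (A : V →ₗ[ℂ] W) :
    finrank ℂ (LinearMap.graph A) = finrank ℂ V := by
  rw [LinearMap.graph_eq_range_prod]
  exact LinearMap.finrank_range_of_inj fun a b h => congrArg Prod.fst h

theorem finrank_graphPseudoInv (B : V →ₗ[ℂ] V) :
    finrank ℂ (graphPseudoInv B) = finrank ℂ V :=
  (LinearEquiv.finrank_map_eq (LinearEquiv.prodComm ℂ V V) _).trans (finrank_graph B)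

theorem relKer_graph (A : V →ₗ[ℂ] W) : relKer (LinearMap.graph A) = LinearMap.ker A := by
  ext v
  simp [relKer, eq_comm]

theorem relIndef_graph (A : V →ₗ[ℂ] W) : relIndef (LinearMap.graph A) = ⊥ := by
  ext v
  simp [relIndef]

theorem relDom_graph (A : V →ₗ[ℂ] W) : relDom (LinearMap.graph A) = ⊤ := by
  ext v
  simp [relDom]

theorem relIm_graph (A : V →ₗ[ℂ] W) : relIm (LinearMap.graph A) = LinearMap.range A := by
  ext v
  simp [relIm, eq_comm]

theorem relKer_graphPseudoInv (B : V →ₗ[ℂ] V) : relKer (graphPseudoInv B) = ⊥ := by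
  ext v
  simp [relKer]

theorem relIndef_graphPseudoInv (B : V →ₗ[ℂ] V) :
    relIndef (graphPseudoInv B) = LinearMap.ker B := by
  ext v
  simp [relIndef, eq_comm]

theorem relDom_graphPseudoInv (B : V →ₗ[ℂ] V) :
    relDom (graphPseudoInv B) = LinearMap.range B := by
  ext v
  simp [relDom, eq_comm]

theorem relIm_graphPseudoInv (B : V →ₗ[ℂ] V) : relIm (graphPseudoInv B) = ⊤ := by
  ext v
  simp [relIm]

theorem finrank_ker_lt_iff_ne_zero [FiniteDimensional ℂ V] (A : V →ₗ[ℂ] W) :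
    finrank ℂ (LinearMap.ker A) < finrank ℂ V ↔ A ≠ 0 := by
  rw [← not_iff_not, not_not, not_lt, ← LinearMap.ker_eq_top]
  constructor
  · intro h
    exact Submodule.eq_top_of_finrank_eq (le_antisymm (Submodule.finrank_le _) h)
  · intro h
    rw [h, finrank_top]

theorem rank_graph_pos_iff [FiniteDimensional ℂ V] (A : V →ₗ[ℂ] W) :
    finrank ℂ (relKer (LinearMap.graph A)) + finrank ℂ (relIndef (LinearMap.graph A)) <
      finrank ℂ (LinearMap.graph A) ↔ A ≠ 0 := by
  rw [relKer_graph, relIndef_graph, finrank_graph, finrank_bot, add_zero,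
    finrank_ker_lt_iff_ne_zero]

theorem rank_graphPseudoInv_pos_iff [FiniteDimensional ℂ V] (B : V →ₗ[ℂ] V) :
    finrank ℂ (relKer (graphPseudoInv B)) + finrank ℂ (relIndef (graphPseudoInv B)) <
      finrank ℂ (graphPseudoInv B) ↔ B ≠ 0 := by
  rw [relKer_graphPseudoInv, relIndef_graphPseudoInv, finrank_graphPseudoInv, finrank_bot,
    zero_add, finrank_ker_lt_iff_ne_zero]

theorem exists_eq_graph_of_relDom_eq_top [FiniteDimensional ℂ V] [FiniteDimensional ℂ W]
    {P : Submodule ℂ (V × W)} (hdim : finrank ℂ P = finrank ℂ V) (hdom : relDom P = ⊤) :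
    ∃ A : V →ₗ[ℂ] W, P = LinearMap.graph A := by
  have hsurj : Function.Surjective (LinearMap.fst ℂ V W ∘ₗ P.subtype) := by
    rw [← LinearMap.range_eq_top, LinearMap.range_comp, Submodule.range_subtype]
    exact hdom
  exact Submodule.exists_eq_graph
    ⟨(LinearMap.injective_iff_surjective_of_finrank_eq_finrank hdim).mpr hsurj, hsurj⟩

theorem exists_eq_graphPseudoInv_of_relIm_eq_top [FiniteDimensional ℂ V]
    {P : Submodule ℂ (V × V)} (hdim : finrank ℂ P = finrank ℂ V) (him : relIm P = ⊤) :
    ∃ B : V →ₗ[ℂ] V, P = graphPseudoInv B := by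
  obtain ⟨B, hB⟩ := exists_eq_graph_of_relDom_eq_top
    (P := P.map (LinearEquiv.prodComm ℂ V V).toLinearMap)
    ((LinearEquiv.finrank_map_eq (LinearEquiv.prodComm ℂ V V) P).trans hdim)
    (by rw [relDom, ← Submodule.map_comp]; exact him)
  refine ⟨B, ?_⟩
  rw [graphPseudoInv, ← hB, ← Submodule.map_comp]
  exact (Submodule.map_id P).symm

theorem isHinge_graph_graphPseudoInv_iff [FiniteDimensional ℂ V] (A B : V →ₗ[ℂ] V) :
    IsHinge ![LinearMap.graph A, graphPseudoInv B] ↔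
      (LinearMap.range A = LinearMap.ker B ∧ LinearMap.ker A = LinearMap.range B ∧
        A ≠ 0 ∧ B ≠ 0) := by
  constructor
  · intro h
    refine ⟨?_, ?_, (rank_graph_pos_iff A).mp (h.rk_pos 0),
      (rank_graphPseudoInv_pos_iff B).mp (h.rk_pos 1)⟩
    · rw [← relIm_graph, ← relIndef_graphPseudoInv]
      exact h.im_eq_indef 0 one_lt_two
    · rw [← relKer_graph, ← relDom_graphPseudoInv]
      exact h.ker_eq_dom 0 one_lt_two
  · rintro ⟨him, hker, hA, hB⟩
    refine ⟨two_pos, ?_, ?_, ?_, relDom_graph A, relIm_graphPseudoInv B, ?_⟩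
    · exact Fin.forall_fin_two.mpr ⟨finrank_graph A, finrank_graphPseudoInv B⟩
    · intro j hj
      obtain rfl : j = 0 := by omega
      exact (relKer_graph A).trans (hker.trans (relDom_graphPseudoInv B).symm)
    · intro j hj
      obtain rfl : j = 0 := by omega
      exact (relIm_graph A).trans (him.trans (relIndef_graphPseudoInv B).symm)
    · exact Fin.forall_fin_two.mpr
        ⟨(rank_graph_pos_iff A).mpr hA, (rank_graphPseudoInv_pos_iff B).mpr hB⟩

end LinearRelation

theorem two_term_hinge_characterization
    {V : Type*} [AddCommGroup V] [Module ℂ V] [FiniteDimensional ℂ V] :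
    (∀ A B : V →ₗ[ℂ] V,
      IsHinge ![LinearMap.graph A, graphPseudoInv B] ↔
        (LinearMap.range A = LinearMap.ker B ∧ LinearMap.ker A = LinearMap.range B ∧
          A ≠ 0 ∧ B ≠ 0)) ∧
    (∀ P : Fin 2 → Submodule ℂ (V × V), IsHinge P →
      ∃ A B : V →ₗ[ℂ] V,
        LinearMap.range A = LinearMap.ker B ∧ LinearMap.ker A = LinearMap.range B ∧
        A ≠ 0 ∧ B ≠ 0 ∧ P 0 = LinearMap.graph A ∧ P 1 = graphPseudoInv B) := by
  refine ⟨isHinge_graph_graphPseudoInv_iff, fun P hP => ?_⟩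
  obtain ⟨A, hA⟩ := exists_eq_graph_of_relDom_eq_top (hP.dim_eq 0) hP.dom_first
  obtain ⟨B, hB⟩ := exists_eq_graphPseudoInv_of_relIm_eq_top (hP.dim_eq 1) hP.im_last
  have hPAB : P = ![LinearMap.graph A, graphPseudoInv B] := by
    ext1 j
    fin_cases j
    exacts [hA, hB]
  obtain ⟨him, hker, hA0, hB0⟩ := (isHinge_graph_graphPseudoInv_iff A B).mp (hPAB ▸ hP)
  exact ⟨A, B, him, hker, hA0, hB0, hA, hB⟩
end

section
/- Let (P_1,…,P_k) be a hinge on an n-dimensional complex vector space V, fix m ∈ {0,1,…,n}, and consider the operators λ^m(P_1),…,λ^m(P_k): Λ^m V → Λ^m V obtained from canonical basis pairs. Then exactly one of the following two possibilities holds: (1) there is a unique j with λ^m(P_j) ≠ 0; (2) there exists j such that λ^m(P_j) ≠ 0 and λ^m(P_{j+1}) ≠ 0 while λ^m(P_t) = 0 for all t ∉ {j, j+1}; in this case λ^m(P_j) and λ^m(P_{j+1}) both have rank 1 and each is a nonzero scalar multiple of λ^m(Q_j), where Q_j = Ker P_j ⊕ Im P_j. -/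
open Module

noncomputable section

variable {V W : Type*} [AddCommGroup V] [Module ℂ V] [AddCommGroup W] [Module ℂ W]

/-- The wedge product `x₁ ∧ … ∧ x_m` as an element of the `m`-th exterior power. -/
def ιMultiP (m : ℕ) (x : Fin m → V) : ⋀[ℂ]^m V :=
  ⟨ExteriorAlgebra.ιMulti ℂ m x, ExteriorAlgebra.ιMulti_range ℂ m (Set.mem_range_self x)⟩

/-- `L : Λ^m V → Λ^m W` is the degree-`m` component `λ^m(S)` of the operator obtained from the
canonical basis pair `c` for `S`: it sends each degree-`m` basis monomial
`f₁∧…∧f_α∧g_{i₁}∧…∧g_{i_s}` to `F₁∧…∧F_μ∧G_{i₁}∧…∧G_{i_s}` and every other degree-`m`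
monomial in the chosen basis of `V` to `0`. -/
def IsLambdaM {S : Submodule ℂ (V × W)} (c : CanonicalBasisPair S) (m : ℕ)
    (L : (⋀[ℂ]^m V) →ₗ[ℂ] (⋀[ℂ]^m W)) : Prop :=
  (∀ (s : Finset (Fin c.β)) (h1 : c.α + s.card = m) (h2 : c.μ + s.card = m),
      L (ιMultiP m (goodTupleV c s ∘ Fin.cast h1.symm)) =
        ιMultiP m (goodTupleW c s ∘ Fin.cast h2.symm)) ∧
  (∀ x : Fin m → (Fin c.α ⊕ Fin c.β ⊕ Fin c.γ),
      ((∃ i : Fin c.α, Sum.inl i ∉ Set.range x) ∨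
        (∃ l : Fin c.γ, Sum.inr (Sum.inr l) ∈ Set.range x)) →
      L (ιMultiP m fun i => c.bV (x i)) = 0)

end

section AlternatingMaps

variable {V N : Type*} [AddCommGroup V] [Module ℂ V] [AddCommGroup N] [Module ℂ N]

/-- An alternating map vanishing on all tuples of basis vectors that involve an index in `T`
vanishes on all tuples with an entry in the span of the basis vectors indexed by `T`. -/
theorem AlternatingMap.eq_zero_of_mem_span_basis {ι κ : Type*} [Finite ι]
    (A : V [⋀^ι]→ₗ[ℂ] N) (b : Basis κ ℂ V) (T : Set κ)
    (hA : ∀ x : ι → κ, (∃ i, x i ∈ T) → A (fun i => b (x i)) = 0)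
    (z : ι → V) (i : ι) (hz : z i ∈ Submodule.span ℂ (b '' T)) : A z = 0 := by
  classical
  let q : V →ₗ[ℂ] V := b.constr ℂ fun t => if t ∈ T then b t else 0
  have hq : ∀ v ∈ Submodule.span ℂ (b '' T), q v = v := by
    intro v hv
    induction hv using Submodule.span_induction with
    | mem v hv =>
      obtain ⟨t, ht, rfl⟩ := hv
      simp [q, ht]
    | zero => simp
    | add v w _ _ hv hw => rw [map_add, hv, hw]
    | smul a v _ hv => rw [map_smul, hv]
  have h0 : A.toMultilinearMap.compLinearMap
      (fun j => if j = i then q else LinearMap.id) = 0 := by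
    refine Basis.ext_multilinear (fun _ => b) fun x => ?_
    have hx : (fun j => (if j = i then q else LinearMap.id) (b (x j))) =
        Function.update (fun j => b (x j)) i (q (b (x i))) := by
      funext j
      by_cases hj : j = i
      · subst hj; simp
      · simp [hj]
    simp only [MultilinearMap.compLinearMap_apply, AlternatingMap.coe_multilinearMap, hx,
      _root_.zero_apply]
    by_cases ht : x i ∈ T
    · have hqx : q (b (x i)) = b (x i) := hq _ (Submodule.subset_span ⟨_, ht, rfl⟩)
      rw [hqx, Function.update_eq_self i (fun j => b (x j))]
      exact hA x ⟨i, ht⟩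
    · have hqx : q (b (x i)) = 0 := by simp [q, ht]
      rw [hqx]
      exact A.map_update_zero _ _
  have h1 := congrArg (fun f => f z) h0
  simp only [MultilinearMap.compLinearMap_apply, AlternatingMap.coe_multilinearMap,
    _root_.zero_apply] at h1
  convert h1 using 2
  funext j
  by_cases hj : j = i
  · subst hj; simp [hq _ hz]
  · simp [hj]

/-- An alternating map that vanishes on all tuples of basis vectors leaving a fixed set of
indices, enumerated by `e`, takes its values in the line spanned by its value at `b ∘ e`. -/
theorem AlternatingMap.mem_span_singleton_of_basis {ι κ : Type*} [Finite ι]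
    (A : V [⋀^ι]→ₗ[ℂ] N) (b : Basis κ ℂ V) (e : ι → κ)
    (hA : ∀ x : ι → κ, (∃ i, x i ∉ Set.range e) → A (fun i => b (x i)) = 0)
    (z : ι → V) : A z ∈ Submodule.span ℂ {A (fun i => b (e i))} := by
  classical
  have := Fintype.ofFinite ι
  rw [← Submodule.Quotient.mk_eq_zero]
  suffices h : (Submodule.mkQ (Submodule.span ℂ {A fun i => b (e i)})).compAlternatingMap A = 0 from
    congrArg (fun f => f z) h
  refine Basis.ext_alternating b fun x hx => ?_
  simp only [LinearMap.compAlternatingMap_apply, Submodule.mkQ_apply, AlternatingMap.zero_apply,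
    Submodule.Quotient.mk_eq_zero]
  by_cases h : ∃ i, x i ∉ Set.range e
  · rw [hA x h]
    exact Submodule.zero_mem _
  · push Not at h
    choose σ hσ using h
    have hinj : Function.Injective σ := fun i j hij => hx (by rw [← hσ, ← hσ, hij])
    have hp := A.map_perm (fun i => b (e i))
      (Equiv.ofBijective σ (Finite.injective_iff_bijective.mp hinj))
    have hc : (fun i => b (e i)) ∘ (Equiv.ofBijective σ (Finite.injective_iff_bijective.mp hinj))
        = fun i => b (x i) := by
      funext i
      simp [hσ]
    rw [← hc, hp]
    exact Submodule.smul_of_tower_mem _ _ (Submodule.mem_span_singleton_self _)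

/-- The wedge product of a linearly independent tuple is nonzero. -/
theorem ιMultiP_ne_zero {m : ℕ} {v : Fin m → V} (hv : LinearIndependent ℂ v) :
    ιMultiP m v ≠ 0 := by
  obtain ⟨p, hp⟩ := LinearMap.exists_leftInverse_of_injective
    (Fintype.linearCombination ℂ v) (LinearMap.ker_eq_bot.mpr
      hv.fintypeLinearCombination_injective)
  intro h0
  have h1 := exteriorPower.alternatingMapLinearEquiv_apply_ιMulti
    ((Pi.basisFun ℂ (Fin m)).det.compLinearMap p) v
  change _ = 0 at h0
  have h2 : (fun i => p (v i)) = Pi.basisFun ℂ (Fin m) := by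
    funext i
    have := LinearMap.congr_fun hp (Pi.single i 1)
    simpa [Fintype.linearCombination_apply_single] using this
  have h3 : exteriorPower.ιMulti ℂ m v = 0 := h0
  rw [h3, map_zero, AlternatingMap.compLinearMap_apply] at h1
  have h4 : (Pi.basisFun ℂ (Fin m)).det (fun i => p (v i)) = 1 := by
    rw [h2, Basis.det_self]
  exact zero_ne_one (h1.trans h4)

/-- Membership of all values of a linear map on an exterior power in a submodule can be tested on
wedge products. -/
theorem exteriorPower_map_mem {m : ℕ} (L : (⋀[ℂ]^m V) →ₗ[ℂ] N) (S : Submodule ℂ N)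
    (h : ∀ z : Fin m → V, L (ιMultiP m z) ∈ S) (y : ⋀[ℂ]^m V) : L y ∈ S := by
  have hy : y ∈ Submodule.span ℂ (Set.range (exteriorPower.ιMulti ℂ m (M := V))) := by
    rw [exteriorPower.ιMulti_span]; trivial
  have hle : Submodule.span ℂ (Set.range (exteriorPower.ιMulti ℂ m (M := V))) ≤ S.comap L := by
    rw [Submodule.span_le]
    rintro _ ⟨z, rfl⟩
    exact h z
  exact hle hy

/-- The wedge products of two tuples are proportional if the first is linearly independent and
the entries of the second lie in its span. -/
theorem ιMultiP_mem_span_singleton {m : ℕ} {v w : Fin m → V} (hv : LinearIndependent ℂ v)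
    (hw : ∀ i, w i ∈ Submodule.span ℂ (Set.range v)) :
    ιMultiP m w ∈ Submodule.span ℂ {ιMultiP m v} := by
  have := AlternatingMap.mem_span_singleton_of_basis
    ((exteriorPower.ιMulti ℂ m).compLinearMap (Submodule.span ℂ (Set.range v)).subtype)
    (Basis.span hv) id (fun x ⟨i, hi⟩ => absurd ⟨x i, rfl⟩ hi) (fun i => ⟨w i, hw i⟩)
  simp only [AlternatingMap.compLinearMap_apply, Submodule.subtype_apply, id,
    Basis.span_apply] at this
  exact this

end AlternatingMaps

section RankOneForm

variable {V : Type*} [AddCommGroup V] [Module ℂ V]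

/-- The operator `L` on `Λ^m V` kills all wedge products with a factor in `K`, and its range is
the line spanned by the wedge product of a basis of `I`. -/
def IsRankOneForm (K I : Submodule ℂ V) (m : ℕ) (L : (⋀[ℂ]^m V) →ₗ[ℂ] (⋀[ℂ]^m V)) : Prop :=
  (∀ (z : Fin m → V) (i : Fin m), z i ∈ K → L (ιMultiP m z) = 0) ∧
  ∃ w : Fin m → V, LinearIndependent ℂ w ∧ Submodule.span ℂ (Set.range w) = I ∧
    LinearMap.range L = Submodule.span ℂ {ιMultiP m w}

theorem IsRankOneForm.finrank_range {K I : Submodule ℂ V} {m : ℕ}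
    {L : (⋀[ℂ]^m V) →ₗ[ℂ] (⋀[ℂ]^m V)} (h : IsRankOneForm K I m L) :
    finrank ℂ (LinearMap.range L) = 1 := by
  obtain ⟨-, w, hw, -, hr⟩ := h
  rw [hr]
  exact finrank_span_singleton (ιMultiP_ne_zero hw)

/-- Two operators of the same rank one form are proportional. -/
theorem IsRankOneForm.exists_eq_smul [FiniteDimensional ℂ V] {K I : Submodule ℂ V} {m : ℕ}
    (hK : finrank ℂ K + m = finrank ℂ V) {L L' : (⋀[ℂ]^m V) →ₗ[ℂ] (⋀[ℂ]^m V)}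
    (h : IsRankOneForm K I m L) (h' : IsRankOneForm K I m L') :
    ∃ a : ℂ, a ≠ 0 ∧ L = a • L' := by
  obtain ⟨C, hC⟩ := Submodule.exists_isCompl K
  have hCm : finrank ℂ C = m := by
    have := Submodule.finrank_add_eq_of_isCompl hC
    omega
  let b : Basis (Fin (finrank ℂ K) ⊕ Fin m) ℂ V :=
    ((finBasis ℂ K).prod (finBasisOfFinrankEq ℂ C hCm)).map (Submodule.prodEquivOfIsCompl K C hC)
  have hb : ∀ i, b (Sum.inl i) ∈ K := by
    intro i
    simp [b]
  let u : Fin m → V := fun i => b (Sum.inr i)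
  have key : ∀ M : (⋀[ℂ]^m V) →ₗ[ℂ] (⋀[ℂ]^m V),
      (∀ (z : Fin m → V) (i : Fin m), z i ∈ K → M (ιMultiP m z) = 0) →
      ∀ y, M y ∈ Submodule.span ℂ {M (ιMultiP m u)} := by
    intro M hM
    refine exteriorPower_map_mem _ _ fun z => ?_
    refine AlternatingMap.mem_span_singleton_of_basis
      (M.compAlternatingMap (exteriorPower.ιMulti ℂ m)) b Sum.inr ?_ z
    rintro x ⟨i, hi⟩
    refine hM _ i ?_
    rcases hx : x i with j | j
    · exact hb j
    · exact absurd ⟨j, hx.symm⟩ hi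
  obtain ⟨hk, w, hw, hwI, hr⟩ := h
  obtain ⟨hk', w', hw', hwI', hr'⟩ := h'
  have hprop : ιMultiP m w ∈ Submodule.span ℂ {ιMultiP m w'} :=
    ιMultiP_mem_span_singleton hw' fun i => by
      rw [hwI', ← hwI]; exact Submodule.subset_span ⟨i, rfl⟩
  have nz : ∀ {M : (⋀[ℂ]^m V) →ₗ[ℂ] (⋀[ℂ]^m V)} {ω : ⋀[ℂ]^m V}, ω ≠ 0 →
      LinearMap.range M = Submodule.span ℂ {ω} →
      (∀ y, M y ∈ Submodule.span ℂ {M (ιMultiP m u)}) → M (ιMultiP m u) ≠ 0 := by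
    intro M ω hω hM hy h0
    obtain ⟨y, hyω⟩ : ω ∈ LinearMap.range M := hM ▸ Submodule.mem_span_singleton_self ω
    have := hy y
    rw [h0, Submodule.span_zero_singleton, Submodule.mem_bot, hyω] at this
    exact hω this
  have hn := nz (ιMultiP_ne_zero hw) hr (key L hk)
  have hn' := nz (ιMultiP_ne_zero hw') hr' (key L' hk')
  have hL : L (ιMultiP m u) ∈ Submodule.span ℂ {ιMultiP m w'} := by
    have h1 : L (ιMultiP m u) ∈ LinearMap.range L := ⟨_, rfl⟩
    rw [hr] at h1
    exact (Submodule.span_singleton_le_iff_mem _ _).mpr hprop h1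
  have hL' : L' (ιMultiP m u) ∈ Submodule.span ℂ {ιMultiP m w'} := hr' ▸ ⟨_, rfl⟩
  obtain ⟨x, hx⟩ := Submodule.mem_span_singleton.mp hL
  obtain ⟨y, hy⟩ := Submodule.mem_span_singleton.mp hL'
  have hx0 : x ≠ 0 := by rintro rfl; exact hn (by rw [← hx, zero_smul])
  have hy0 : y ≠ 0 := by rintro rfl; exact hn' (by rw [← hy, zero_smul])
  refine ⟨x / y, div_ne_zero hx0 hy0, ?_⟩
  have hu : (L - (x / y) • L') (ιMultiP m u) = 0 := by
    rw [LinearMap.sub_apply, LinearMap.smul_apply, ← hx, ← hy, smul_smul, div_mul_cancel₀ _ hy0,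
      sub_self]
  have hz := key (L - (x / y) • L') fun z i hi => by
    rw [LinearMap.sub_apply, LinearMap.smul_apply, hk z i hi, hk' z i hi, smul_zero, sub_zero]
  rw [← sub_eq_zero]
  ext1
  ext1 z
  have := hz (exteriorPower.ιMulti ℂ m z)
  rw [hu, Submodule.span_zero_singleton, Submodule.mem_bot] at this
  exact this

end RankOneForm

section GoodTuples

/-- The indices of the tuple `f₁, …, f_α, g_{i₁}, …, g_{i_s}` in a canonical basis. -/
def goodIdx {α β γ : ℕ} (s : Finset (Fin β)) : Fin (α + s.card) → Fin α ⊕ Fin β ⊕ Fin γ :=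
  Fin.addCases Sum.inl fun j => Sum.inr (Sum.inl ((s.orderIsoOfFin rfl j : s) : Fin β))

theorem goodIdx_castAdd {α β γ : ℕ} (s : Finset (Fin β)) (i : Fin α) :
    goodIdx (γ := γ) s (Fin.castAdd _ i) = Sum.inl i := by
  simp [goodIdx]

theorem goodIdx_natAdd {α β γ : ℕ} (s : Finset (Fin β)) (j : Fin s.card) :
    goodIdx (α := α) (γ := γ) s (Fin.natAdd _ j) =
      Sum.inr (Sum.inl ((s.orderIsoOfFin rfl j : s) : Fin β)) := by
  simp [goodIdx]

theorem goodIdx_injective {α β γ : ℕ} (s : Finset (Fin β)) :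
    Function.Injective (goodIdx (α := α) (γ := γ) s) := by
  intro i j
  refine Fin.addCases (fun i => ?_) (fun i => ?_) i <;>
    refine Fin.addCases (fun j => ?_) (fun j => ?_) j <;>
    simp only [goodIdx_castAdd, goodIdx_natAdd] <;> intro h
  · rw [Sum.inl.inj h]
  · cases h
  · cases h
  · rw [(s.orderIsoOfFin rfl).injective (Subtype.ext (Sum.inl.inj (Sum.inr.inj h)))]

theorem range_goodIdx {α β γ : ℕ} (s : Finset (Fin β)) :
    Set.range (goodIdx (α := α) (γ := γ) s) =
      Set.range Sum.inl ∪ (fun j => Sum.inr (Sum.inl j)) '' (s : Set (Fin β)) := by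
  ext x
  constructor
  · rintro ⟨i, rfl⟩
    refine Fin.addCases (fun i => ?_) (fun i => ?_) i
    · rw [goodIdx_castAdd]; exact Or.inl ⟨i, rfl⟩
    · rw [goodIdx_natAdd]; exact Or.inr ⟨_, Subtype.prop _, rfl⟩
  · rintro (⟨i, rfl⟩ | ⟨j, hj, rfl⟩)
    · exact ⟨_, goodIdx_castAdd s i⟩
    · obtain ⟨i, hi⟩ := (s.orderIsoOfFin rfl).surjective ⟨j, hj⟩
      exact ⟨Fin.natAdd _ i, by rw [goodIdx_natAdd, hi]⟩

variable {V W : Type*} [AddCommGroup V] [Module ℂ V] [AddCommGroup W] [Module ℂ W]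
  {S : Submodule ℂ (V × W)} (c : CanonicalBasisPair S)

theorem goodTupleV_eq (s : Finset (Fin c.β)) : goodTupleV c s = c.bV ∘ goodIdx s := by
  funext i
  refine Fin.addCases (fun i => ?_) (fun i => ?_) i
  · rw [Function.comp_apply, goodIdx_castAdd]; simp [goodTupleV]
  · rw [Function.comp_apply, goodIdx_natAdd]; simp [goodTupleV]

theorem goodTupleW_eq (s : Finset (Fin c.β)) : goodTupleW c s = c.bW ∘ goodIdx s := by
  funext i
  refine Fin.addCases (fun i => ?_) (fun i => ?_) i
  · rw [Function.comp_apply, goodIdx_castAdd]; simp [goodTupleW]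
  · rw [Function.comp_apply, goodIdx_natAdd]; simp [goodTupleW]

end GoodTuples

namespace CanonicalBasisPair

variable {V W : Type*} [AddCommGroup V] [Module ℂ V] [AddCommGroup W] [Module ℂ W]
  {S : Submodule ℂ (V × W)} (c : CanonicalBasisPair S)

theorem inl_mem (i : Fin c.μ) : ((0 : V), c.bW (Sum.inl i)) ∈ S :=
  c.hspan.ge (Submodule.subset_span (Or.inl (Or.inl ⟨i, rfl⟩)))

theorem pair_mem (j : Fin c.β) :
    (c.bV (Sum.inr (Sum.inl j)), c.bW (Sum.inr (Sum.inl j))) ∈ S :=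
  c.hspan.ge (Submodule.subset_span (Or.inl (Or.inr ⟨j, rfl⟩)))

theorem inr_mem (l : Fin c.γ) : (c.bV (Sum.inr (Sum.inr l)), (0 : W)) ∈ S :=
  c.hspan.ge (Submodule.subset_span (Or.inr ⟨l, rfl⟩))

/-- The coordinates of the members of a linear relation in a canonical basis pair. -/
theorem repr_of_mem {p : V × W} (hp : p ∈ S) :
    (∀ i, c.bV.repr p.1 (Sum.inl i) = 0) ∧ (∀ l, c.bW.repr p.2 (Sum.inr (Sum.inr l)) = 0) ∧
      ∀ j, c.bV.repr p.1 (Sum.inr (Sum.inl j)) = c.bW.repr p.2 (Sum.inr (Sum.inl j)) := by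
  replace hp := c.hspan.le hp
  induction hp using Submodule.span_induction with
  | mem p hp =>
    rcases hp with (⟨i, rfl⟩ | ⟨j, rfl⟩) | ⟨l, rfl⟩ <;> simp [Finsupp.single_apply]
  | zero => simp
  | add p q _ _ hp hq =>
    refine ⟨fun i => ?_, fun i => ?_, fun i => ?_⟩
    · simp [hp.1 i, hq.1 i]
    · simp [hp.2.1 i, hq.2.1 i]
    · simp [hp.2.2 i, hq.2.2 i]
  | smul a p _ hp =>
    refine ⟨fun i => ?_, fun i => ?_, fun i => ?_⟩
    · simp [hp.1 i]
    · simp [hp.2.1 i]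
    · simp [hp.2.2 i]

theorem relKer_eq :
    relKer S = Submodule.span ℂ (c.bV '' Set.range fun l => Sum.inr (Sum.inr l)) := by
  refine le_antisymm (fun x hx => ?_) (Submodule.span_le.mpr ?_)
  · obtain ⟨h1, -, h2⟩ := c.repr_of_mem (p := (x, 0)) hx
    rw [Basis.mem_span_image]
    rintro (i | j | l) ht
    · exact absurd (h1 i) (Finsupp.mem_support_iff.mp ht)
    · exact absurd ((h2 j).trans (by simp)) (Finsupp.mem_support_iff.mp ht)
    · exact ⟨l, rfl⟩
  · rintro _ ⟨_, ⟨l, rfl⟩, rfl⟩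
    exact c.inr_mem l

theorem relIndef_eq : relIndef S = Submodule.span ℂ (c.bW '' Set.range Sum.inl) := by
  refine le_antisymm (fun x hx => ?_) (Submodule.span_le.mpr ?_)
  · obtain ⟨-, h1, h2⟩ := c.repr_of_mem (p := (0, x)) hx
    rw [Basis.mem_span_image]
    rintro (i | j | l) ht
    · exact ⟨i, rfl⟩
    · exact absurd ((h2 j).symm.trans (by simp)) (Finsupp.mem_support_iff.mp ht)
    · exact absurd (h1 l) (Finsupp.mem_support_iff.mp ht)
  · rintro _ ⟨_, ⟨i, rfl⟩, rfl⟩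
    exact c.inl_mem i

theorem relDom_eq : relDom S = Submodule.span ℂ (c.bV '' Set.range Sum.inr) := by
  refine le_antisymm ?_ (Submodule.span_le.mpr ?_)
  · rintro _ ⟨p, hp, rfl⟩
    rw [Basis.mem_span_image]
    rintro (i | t) ht
    · exact absurd ((c.repr_of_mem hp).1 i) (Finsupp.mem_support_iff.mp ht)
    · exact ⟨t, rfl⟩
  · rintro _ ⟨_, ⟨j | l, rfl⟩, rfl⟩
    · exact ⟨_, c.pair_mem j, rfl⟩
    · exact ⟨_, c.inr_mem l, rfl⟩

theorem relIm_eq : relIm S = Submodule.span ℂ (c.bW '' Set.range (Sum.map id Sum.inl)) := by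
  refine le_antisymm ?_ (Submodule.span_le.mpr ?_)
  · rintro _ ⟨p, hp, rfl⟩
    rw [Basis.mem_span_image]
    rintro (i | j | l) ht
    · exact ⟨Sum.inl i, rfl⟩
    · exact ⟨Sum.inr j, rfl⟩
    · exact absurd ((c.repr_of_mem hp).2.1 l) (Finsupp.mem_support_iff.mp ht)
  · rintro _ ⟨_, ⟨i | j, rfl⟩, rfl⟩
    · exact ⟨_, c.inl_mem i, rfl⟩
    · exact ⟨_, c.pair_mem j, rfl⟩

theorem finrank_span_basis_range {ι κ : Type*} [Fintype κ] (b : Basis ι ℂ V) {e : κ → ι}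
    (he : Function.Injective e) :
    finrank ℂ (Submodule.span ℂ (b '' Set.range e)) = Fintype.card κ := by
  rw [← Set.range_comp]
  exact finrank_span_eq_card (b.linearIndependent.comp e he)

theorem finrank_relKer : finrank ℂ (relKer S) = c.γ := by
  rw [c.relKer_eq, finrank_span_basis_range _ fun i j h => Sum.inr_injective (Sum.inr_injective h),
    Fintype.card_fin]

theorem finrank_relIndef : finrank ℂ (relIndef S) = c.μ := by
  rw [c.relIndef_eq, finrank_span_basis_range _ Sum.inl_injective, Fintype.card_fin]

theorem finrank_eq_sum : finrank ℂ V = c.α + c.β + c.γ := by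
  rw [finrank_eq_card_basis c.bV]
  simp [add_assoc]

theorem finrank_relation : finrank ℂ S = c.μ + c.β + c.γ := by
  have := Module.Finite.of_basis c.bV
  have := Module.Finite.of_basis c.bW
  have h := LinearMap.finrank_range_add_finrank_ker ((LinearMap.fst ℂ V W).domRestrict S)
  rw [LinearMap.range_domRestrict] at h
  have hk : finrank ℂ (LinearMap.ker ((LinearMap.fst ℂ V W).domRestrict S)) =
      finrank ℂ (relIndef S) := by
    have hz : ∀ p : LinearMap.ker ((LinearMap.fst ℂ V W).domRestrict S),
        p.1.1 = ((0 : V), p.1.1.2) := fun p => Prod.ext p.2 rfl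
    exact LinearEquiv.finrank_eq
      { toFun := fun p => ⟨p.1.1.2, show ((0 : V), p.1.1.2) ∈ S from hz p ▸ p.1.2⟩
        invFun := fun w => ⟨⟨(0, w), w.2⟩, rfl⟩
        map_add' := fun _ _ => rfl
        map_smul' := fun _ _ => rfl
        left_inv := fun p => Subtype.ext (Subtype.ext (hz p).symm)
        right_inv := fun _ => rfl }
  change finrank ℂ (relDom S) + _ = _ at h
  rw [hk, c.finrank_relDom, c.finrank_relIndef] at h
  omega

end CanonicalBasisPair

namespace IsLambdaM

variable {V W : Type*} [AddCommGroup V] [Module ℂ V] [AddCommGroup W] [Module ℂ W]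

theorem map_goodIdx {S : Submodule ℂ (V × W)} {c : CanonicalBasisPair S} {m : ℕ}
    {L : (⋀[ℂ]^m V) →ₗ[ℂ] (⋀[ℂ]^m W)} (hL : IsLambdaM c m L) (hα : c.α = c.μ)
    (s : Finset (Fin c.β)) (hs : c.α + s.card = m) :
    L (ιMultiP m fun i => c.bV (goodIdx s (Fin.cast hs.symm i))) =
      ιMultiP m fun i => c.bW (goodIdx s (Fin.cast (hα ▸ hs.symm) i)) := by
  have := hL.1 s hs (hα ▸ hs)
  rwa [goodTupleV_eq, goodTupleW_eq] at this

theorem linearIndependent_goodIdx {S : Submodule ℂ (V × W)} (c : CanonicalBasisPair S) {m : ℕ}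
    (s : Finset (Fin c.β)) (hs : m = c.μ + s.card) :
    LinearIndependent ℂ fun i : Fin m => c.bW (goodIdx s (Fin.cast hs i)) :=
  c.bW.linearIndependent.comp _ ((goodIdx_injective s).comp (Fin.cast_injective hs))

/-- For a relation with `α = μ`, the operator `λ^m` is nonzero exactly in the degrees
`α ≤ m ≤ α + β`. -/
theorem ne_zero_iff {S : Submodule ℂ (V × W)} {c : CanonicalBasisPair S} {m : ℕ}
    {L : (⋀[ℂ]^m V) →ₗ[ℂ] (⋀[ℂ]^m W)} (hL : IsLambdaM c m L) (hα : c.α = c.μ) :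
    L ≠ 0 ↔ c.α ≤ m ∧ m ≤ c.α + c.β := by
  constructor
  · intro h0
    by_contra hm
    refine h0 (exteriorPower.linearMap_ext (Basis.ext_alternating c.bV fun x hx => ?_))
    refine hL.2 x ?_
    by_contra hx'
    push Not at hx'
    obtain ⟨h1, h2⟩ := hx'
    refine hm ⟨?_, ?_⟩
    · choose y hy using h1
      simpa using Fintype.card_le_of_injective y fun i j hij =>
        Sum.inl_injective (by rw [← hy i, ← hy j, hij])
    · have h3 : ∀ i, ∃ t : Fin c.α ⊕ Fin c.β, Sum.map id Sum.inl t = x i := by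
        intro i
        rcases hi : x i with j | j | j
        · exact ⟨Sum.inl j, rfl⟩
        · exact ⟨Sum.inr j, rfl⟩
        · exact absurd ⟨i, hi⟩ (h2 j)
      choose y hy using h3
      simpa using Fintype.card_le_of_injective y fun i j hij => hx (by rw [← hy i, ← hy j, hij])
  · rintro ⟨h1, h2⟩ rfl
    obtain ⟨s, -, hs⟩ := Finset.exists_subset_card_eq
      (s := (Finset.univ : Finset (Fin c.β))) (n := m - c.α) (by simp; omega)
    refine ιMultiP_ne_zero (linearIndependent_goodIdx c (m := m) s (by omega)) ?_
    rw [← hL.map_goodIdx hα s (by omega), LinearMap.zero_apply]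

theorem isRankOneForm {S : Submodule ℂ (V × V)} {c : CanonicalBasisPair S} {m : ℕ}
    {L : (⋀[ℂ]^m V) →ₗ[ℂ] (⋀[ℂ]^m V)} (hL : IsLambdaM c m L) (hα : c.α = c.μ)
    (s : Finset (Fin c.β)) (hs : c.α + s.card = m) (T : Set (Fin c.α ⊕ Fin c.β ⊕ Fin c.γ))
    (hT : ∀ x : Fin m → _, (∃ i, x i ∈ T) → L (ιMultiP m fun i => c.bV (x i)) = 0)
    (hsT : ∀ t, t ∉ Set.range (goodIdx (α := c.α) (γ := c.γ) s) → t ∈ T) :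
    IsRankOneForm (Submodule.span ℂ (c.bV '' T))
      (Submodule.span ℂ (c.bW '' Set.range (goodIdx s))) m L := by
  refine ⟨fun z i hz => AlternatingMap.eq_zero_of_mem_span_basis
    (L.compAlternatingMap (exteriorPower.ιMulti ℂ m)) c.bV T hT z i hz, _,
    linearIndependent_goodIdx c s (hα ▸ hs.symm), ?_, ?_⟩
  · rw [← Set.range_comp]
    congr 1
    exact (finCongr (hα ▸ hs.symm : m = c.μ + s.card)).surjective.range_comp (c.bW ∘ goodIdx s)
  · rw [← hL.map_goodIdx hα s hs]
    refine le_antisymm ?_ ((Submodule.span_singleton_le_iff_mem _ _).mpr ⟨_, rfl⟩)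
    rintro _ ⟨y, rfl⟩
    refine exteriorPower_map_mem _ _ (fun z => ?_) y
    refine AlternatingMap.mem_span_singleton_of_basis
      (L.compAlternatingMap (exteriorPower.ιMulti ℂ m)) c.bV _ ?_ z
    rintro x ⟨i, hi⟩
    refine hT x ⟨i, hsT _ ?_⟩
    rintro ⟨j, hj⟩
    exact hi ⟨Fin.cast hs j, by simpa using hj⟩

/-- In the highest degree in which it is nonzero, `λ^m` has rank one. -/
theorem isRankOneForm_top {S : Submodule ℂ (V × V)} {c : CanonicalBasisPair S} {m : ℕ}
    {L : (⋀[ℂ]^m V) →ₗ[ℂ] (⋀[ℂ]^m V)} (hL : IsLambdaM c m L) (hα : c.α = c.μ)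
    (hm : c.α + c.β = m) : IsRankOneForm (relKer S) (relIm S) m L := by
  have h := hL.isRankOneForm hα Finset.univ (by simpa using hm)
    (Set.range fun l => Sum.inr (Sum.inr l)) ?_ ?_
  · rw [c.relKer_eq, c.relIm_eq]
    convert h using 4
    rw [range_goodIdx]
    ext (i | j | l) <;> simp
  · rintro x ⟨i, l, hl⟩
    exact hL.2 x (Or.inr ⟨l, i, hl.symm⟩)
  · rw [range_goodIdx]
    rintro (i | j | l) <;> simp

/-- In the lowest degree in which it is nonzero, `λ^m` has rank one. -/
theorem isRankOneForm_bot {S : Submodule ℂ (V × V)} {c : CanonicalBasisPair S} {m : ℕ}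
    {L : (⋀[ℂ]^m V) →ₗ[ℂ] (⋀[ℂ]^m V)} (hL : IsLambdaM c m L) (hα : c.α = c.μ)
    (hm : c.α = m) : IsRankOneForm (relDom S) (relIndef S) m L := by
  have h := hL.isRankOneForm hα ∅ (by simpa using hm) (Set.range Sum.inr) ?_ ?_
  · rw [range_goodIdx, Finset.coe_empty, Set.image_empty, Set.union_empty] at h
    rwa [c.relDom_eq, c.relIndef_eq]
  · rintro x ⟨i, t, ht⟩
    refine hL.2 x (Or.inl ?_)
    by_contra! h1
    choose y hy using h1
    have hinj : Function.Injective y := fun a b hab =>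
      Sum.inl_injective (by rw [← hy a, ← hy b, hab])
    obtain ⟨a, rfl⟩ := ((Fintype.bijective_iff_injective_and_card y).mpr
      ⟨hinj, by simpa using hm⟩).surjective i
    rw [hy a] at ht
    cases ht
  · rw [range_goodIdx]
    rintro (i | t) <;> simp

end IsLambdaM

/-- The alternative for hinges: for a hinge `(P_1,…,P_k)` and a degree `m`, either exactly one
of the operators `λ^m(P_j)` is nonzero, or exactly two consecutive ones `λ^m(P_j), λ^m(P_{j+1})`
are nonzero, in which case both have rank 1 and both are nonzero scalar multiples of
`λ^m(Q_j)` where `Q_j = Ker P_j ⊕ Im P_j`. -/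
theorem hinge_lambda_alternative
    {V : Type*} [AddCommGroup V] [Module ℂ V] [FiniteDimensional ℂ V]
    {n k : ℕ} (hn : finrank ℂ V = n)
    (P : Fin k → Submodule ℂ (V × V)) (h : IsHinge P)
    (m : ℕ) (hm : m ≤ n)
    (c : ∀ j, CanonicalBasisPair (P j))
    (L : ∀ j : Fin k, (⋀[ℂ]^m V) →ₗ[ℂ] (⋀[ℂ]^m V))
    (hL : ∀ j, IsLambdaM (c j) m (L j)) :
    Xor'
      (∃! j : Fin k, L j ≠ 0)
      (∃ (j : ℕ) (hj : j + 1 < k),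
        L ⟨j, by omega⟩ ≠ 0 ∧ L ⟨j + 1, hj⟩ ≠ 0 ∧
        (∀ t : Fin k, t.1 ≠ j → t.1 ≠ j + 1 → L t = 0) ∧
        finrank ℂ (LinearMap.range (L ⟨j, by omega⟩)) = 1 ∧
        finrank ℂ (LinearMap.range (L ⟨j + 1, hj⟩)) = 1 ∧
        (∀ (cQ : CanonicalBasisPair ((relKer (P ⟨j, by omega⟩)).prod (relIm (P ⟨j, by omega⟩))))
           (LQ : (⋀[ℂ]^m V) →ₗ[ℂ] (⋀[ℂ]^m V)), IsLambdaM cQ m LQ →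
          (∃ a : ℂ, a ≠ 0 ∧ L ⟨j, by omega⟩ = a • LQ) ∧
          (∃ b : ℂ, b ≠ 0 ∧ L ⟨j + 1, hj⟩ = b • LQ))) := by
  have hsum : ∀ j, n = (c j).α + (c j).β + (c j).γ := fun j => hn ▸ (c j).finrank_eq_sum
  have hα : ∀ j, (c j).α = (c j).μ := fun j => by
    have h1 := h.dim_eq j
    rw [(c j).finrank_relation, hn] at h1
    have := hsum j
    omega
  have hβ : ∀ j, 0 < (c j).β := fun j => by
    have h1 := h.rk_pos j
    rw [(c j).finrank_relation, (c j).finrank_relKer, (c j).finrank_relIndef] at h1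
    omega
  have hstep : ∀ (j : ℕ) (hj : j + 1 < k),
      (c ⟨j + 1, hj⟩).α = (c ⟨j, by omega⟩).α + (c ⟨j, by omega⟩).β := fun j hj => by
    rw [hα, hα, ← (c _).finrank_relIndef, ← h.im_eq_indef j hj, (c _).finrank_relIm]
  have hfirst : (c ⟨0, h.pos⟩).α = 0 := by
    have h1 := (c ⟨0, h.pos⟩).finrank_relDom
    rw [h.dom_first, finrank_top, hn] at h1
    have := hsum ⟨0, h.pos⟩
    omega
  have hlast : (c ⟨k - 1, by have := h.pos; omega⟩).α +
      (c ⟨k - 1, by have := h.pos; omega⟩).β = n := by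
    have h1 := (c ⟨k - 1, by have := h.pos; omega⟩).finrank_relIm
    rw [h.im_last, finrank_top, hn] at h1
    rw [h1, hα]
  have hne : ∀ j, L j ≠ 0 ↔ (c j).α ≤ m ∧ m ≤ (c j).α + (c j).β :=
    fun j => (hL j).ne_zero_iff (hα j)
  have hex : ∀ (j : ℕ) (hj : j < k), m ≤ (c ⟨j, hj⟩).α + (c ⟨j, hj⟩).β → ∃ i, L i ≠ 0 := by
    intro j
    induction j with
    | zero => exact fun hj hm' => ⟨_, (hne _).mpr ⟨hfirst.le.trans (Nat.zero_le m), hm'⟩⟩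
    | succ j ih =>
      intro hj hm'
      by_cases hlt : (c ⟨j + 1, hj⟩).α ≤ m
      · exact ⟨_, (hne _).mpr ⟨hlt, hm'⟩⟩
      · exact ih (by omega) (by rw [← hstep j hj]; omega)
  have hmono : ∀ (i d : ℕ) (hd : i + 1 + d < k),
      (c ⟨i, by omega⟩).α + (c ⟨i, by omega⟩).β + d ≤ (c ⟨i + 1 + d, hd⟩).α := by
    intro i d
    induction d with
    | zero => exact fun hd => (hstep i hd).ge
    | succ d ih =>
      intro hd
      have h1 := ih (by omega)
      have h2 := hstep (i + 1 + d) hd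
      have h3 := hβ ⟨i + 1 + d, by omega⟩
      change _ ≤ (c ⟨i + 1 + d + 1, hd⟩).α
      omega
  have hpair : ∀ i j : Fin k, i < j → L i ≠ 0 → L j ≠ 0 →
      i.1 + 1 = j.1 ∧ (c i).α + (c i).β = m := by
    rintro ⟨i, hi⟩ ⟨j, hj⟩ hij hi0 hj0
    obtain ⟨d, rfl⟩ := Nat.exists_eq_add_of_le (show i + 1 ≤ j from hij)
    have h1 := hmono i d hj
    have h2 := (hne _).mp hi0
    have h3 := (hne _).mp hj0
    exact ⟨by change i + 1 = i + 1 + d; omega, by omega⟩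
  by_cases hu : ∃! j : Fin k, L j ≠ 0
  · refine Or.inl ⟨hu, ?_⟩
    rintro ⟨j, hj, h1, h2, -⟩
    have := congrArg Fin.val (hu.unique h1 h2)
    simp at this
  · refine Or.inr ⟨?_, hu⟩
    obtain ⟨i, hi⟩ := hex (k - 1) (by have := h.pos; omega) (hlast ▸ hm)
    obtain ⟨i', hi', hii'⟩ : ∃ i', L i' ≠ 0 ∧ i' ≠ i := by
      by_contra! hc
      exact hu ⟨i, hi, fun i' hi' => hc i' hi'⟩
    obtain ⟨a, b, hab, ha, hb⟩ : ∃ a b : Fin k, a < b ∧ L a ≠ 0 ∧ L b ≠ 0 := by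
      rcases lt_or_gt_of_ne hii' with hlt | hlt
      · exact ⟨_, _, hlt, hi', hi⟩
      · exact ⟨_, _, hlt, hi, hi'⟩
    obtain ⟨j, hjk⟩ := a
    obtain ⟨j', hj⟩ := b
    obtain ⟨hj', htop⟩ := hpair _ _ hab ha hb
    obtain rfl : j + 1 = j' := hj'
    have hK : finrank ℂ (relKer (P ⟨j, hjk⟩)) + m = finrank ℂ V := by
      rw [(c _).finrank_relKer, hn, hsum ⟨j, hjk⟩, ← htop]
      omega
    have hform := (hL ⟨j, hjk⟩).isRankOneForm_top (hα _) htop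
    have hform' := (hL ⟨j + 1, hj⟩).isRankOneForm_bot (hα _) ((hstep j hj).trans htop)
    rw [← h.ker_eq_dom j hj, ← h.im_eq_indef j hj] at hform'
    refine ⟨j, hj, ha, hb, fun t ht ht' => ?_, hform.finrank_range, hform'.finrank_range,
      fun cQ LQ hLQ => ?_⟩
    · by_contra h0
      rcases lt_trichotomy t ⟨j, hjk⟩ with hlt | heq | hlt
      · have h1 := (hpair _ _ (hlt.trans hab) h0 hb).1
        have h2 : t.1 < j := hlt
        simp only at h1
        omega
      · exact ht (congrArg Fin.val heq)
      · exact ht' (hpair _ _ hlt ha h0).1.symm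
    · have hkerQ : relKer ((relKer (P ⟨j, hjk⟩)).prod (relIm (P ⟨j, hjk⟩))) =
          relKer (P ⟨j, hjk⟩) := by
        ext v
        exact ⟨fun hv => hv.1, fun hv => ⟨hv, Submodule.zero_mem _⟩⟩
      have himQ : relIm ((relKer (P ⟨j, hjk⟩)).prod (relIm (P ⟨j, hjk⟩))) =
          relIm (P ⟨j, hjk⟩) := Submodule.prod_map_snd _ _
      have hdomQ : relDom ((relKer (P ⟨j, hjk⟩)).prod (relIm (P ⟨j, hjk⟩))) =
          relKer (P ⟨j, hjk⟩) := Submodule.prod_map_fst _ _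
      have h1 := hkerQ ▸ cQ.finrank_relKer
      have h2 := himQ ▸ cQ.finrank_relIm
      have h3 := cQ.finrank_eq_sum
      have h4 := cQ.finrank_relDom
      rw [hdomQ, h1] at h4
      rw [(c _).finrank_relIm, ← hα] at h2
      have hformQ := hLQ.isRankOneForm_top (by omega) (by omega)
      rw [hkerQ, himQ] at hformQ
      exact ⟨hform.exists_eq_smul hK hformQ, hform'.exists_eq_smul hK hformQ⟩
end
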